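/- arXiv:0907.1529 — 13 statements merged into one kernel-verified Lean document; each statement's English description precedes it below -/
import Mathlib

section
/- If a 2×2 symplectic quaternionic matrix A has infinitely many left eigenvalues, then there exist a quaternion q with |q| = 1 and a real number θ with sin θ ≠ 0 such that A = [[q·cos θ, −q·sin θ], [q·sin θ, q·cos θ]]. -/
open Quaternion Matrix

/-- Splitting off the real quadratic `p² = 2 (re p) p - |p|²` from a unilateral quadratic equation. -/
lemma Quaternion.linear_of_quadratic {p a w : ℍ[ℝ]} (h : p * p + a * p + w = 0) :
    (((2 * p.re : ℝ) : ℍ[ℝ]) + a) * p = ((normSq p : ℝ) : ℍ[ℝ]) - w := by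
  have h1 : p * p = ((2 * p.re : ℝ) : ℍ[ℝ]) * p - ((normSq p : ℝ) : ℍ[ℝ]) := by
    ext <;> simp <;> (try rw [normSq_def']) <;> ring
  rw [h1] at h
  rw [add_mul, ← sub_eq_zero, ← h]
  abel

lemma Quaternion.norm_trace_relations {p u w : ℍ[ℝ]} (hw : normSq w = 1)
    (h : p * p + (u - w * star u) * p + w = 0) :
    normSq p ^ 2 - 2 * normSq p * w.re + 1 = normSq p *
        ((2 * p.re) ^ 2 + 2 * (2 * p.re) * (u - w * star u).re + normSq (u - w * star u)) ∧
      2 * p.re * (normSq p - 1) + 2 * (u - w * star u).re * normSq p = 0 := by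
  have hlin := linear_of_quadratic h
  have hre : (star (u - w * star u) * w).re = -(u - w * star u).re := by
    rw [normSq_def'] at hw
    simp
    linear_combination (-u.re) * hw
  generalize u - w * star u = a at *
  have hnorm (t : ℝ) : normSq ((t : ℍ[ℝ]) + a) = t ^ 2 + 2 * t * a.re + normSq a := by
    simp [normSq_def']; ring
  have hnorm' (n : ℝ) : normSq ((n : ℍ[ℝ]) - w) = n ^ 2 - 2 * n * w.re + 1 := by
    rw [normSq_def'] at hw ⊢
    simp
    linear_combination hw
  have e1 := congrArg normSq hlin
  rw [map_mul, hnorm, hnorm'] at e1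
  have e2 : normSq (((2 * p.re : ℝ) : ℍ[ℝ]) + a) * p.re =
      (star (((2 * p.re : ℝ) : ℍ[ℝ]) + a) * (((normSq p : ℝ) : ℍ[ℝ]) - w)).re := by
    rw [← hlin, ← mul_assoc, star_mul_self, coe_mul_eq_smul, re_smul, smul_eq_mul]
  rw [hnorm] at e2
  have hn : 0 ≤ normSq p := normSq_nonneg
  generalize normSq p = n at *
  generalize normSq a = g at *
  simp at e2 hre
  refine ⟨by linarith, ?_⟩
  have : (n + 1) * (2 * p.re * (n - 1) + 2 * a.re * n) = 0 := by
    linear_combination (2 * p.re) * e1 - 2 * n * e2 + 2 * n * hre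
  exact (mul_eq_zero.1 this).resolve_left (by positivity)

lemma finite_norm_trace_pairs (α γ ω : ℝ) :
    {x : ℝ × ℝ | x.2 ^ 2 - 2 * x.2 * ω + 1 = x.2 * (x.1 ^ 2 + 2 * x.1 * α + γ) ∧
      x.1 * (x.2 - 1) + 2 * α * x.2 = 0}.Finite := by
  have hN : {n : ℝ | (n ^ 2 - 2 * n * ω + 1) * (n - 1) ^ 2
      - n * (4 * α ^ 2 * n + γ * (n - 1) ^ 2) = 0}.Finite := by
    let P : Polynomial ℝ := (.X ^ 2 - 2 * .X * .C ω + 1) * (.X - 1) ^ 2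
      - .X * (4 * .C α ^ 2 * .X + .C γ * (.X - 1) ^ 2)
    have hP : P ≠ 0 := fun h0 => by
      have := congrArg (Polynomial.eval 0) h0
      simp [P] at this
    refine (Polynomial.finite_setOfPred_isRoot hP).subset fun n hn => ?_
    simpa [P, Polynomial.IsRoot] using hn
  have hT (c : ℝ) : {t : ℝ | t ^ 2 + 2 * t * α + γ = c}.Finite := by
    refine (Set.toFinite {-α + √(c - γ + α ^ 2), -α - √(c - γ + α ^ 2)}).subset fun t ht => ?_
    have ht : t ^ 2 + 2 * t * α + γ = c := ht
    have hs : c - γ + α ^ 2 = (t + α) ^ 2 := by rw [← ht]; ring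
    rw [hs, Real.sqrt_sq_eq_abs]
    rcases abs_choice (t + α) with h | h <;> rw [h] <;> simp
  refine (hN.biUnion fun n _ => (hT ((n ^ 2 - 2 * n * ω + 1) / n)).prod
    (Set.finite_singleton n)).subset ?_
  rintro ⟨t, n⟩ ⟨h1, h2⟩
  simp only at h1 h2
  have hn : n ≠ 0 := by rintro rfl; norm_num at h1
  simp only [Set.mem_iUnion, Set.mem_prod, Set.mem_ofPred_eq, Set.mem_singleton_iff]
  refine ⟨n, ?_, ?_, rfl⟩
  · linear_combination (n - 1) ^ 2 * h1 + n * (t * (n - 1) - 2 * α * n + 2 * α * (n - 1)) * h2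
  · field_simp
    linear_combination -h1

/-- If the quadratic equation attached to a symplectic matrix has infinitely many solutions, then
`w = 1` and `u` is real. -/
lemma Quaternion.real_of_infinite_quadratic_solutions {u w : ℍ[ℝ]} (hw : normSq w = 1)
    (hinf : {p : ℍ[ℝ] | p * p + (u - w * star u) * p + w = 0}.Infinite) :
    w = 1 ∧ star u = u := by
  obtain ⟨p, hp, h0⟩ : ∃ p : ℍ[ℝ], p * p + (u - w * star u) * p + w = 0 ∧
      ((2 * p.re : ℝ) : ℍ[ℝ]) + (u - w * star u) = 0 := by
    by_contra! hne
    refine hinf (((finite_norm_trace_pairs (u - w * star u).re (normSq (u - w * star u))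
      w.re).image fun x => ((x.1 : ℍ[ℝ]) + (u - w * star u))⁻¹ * ((x.2 : ℍ[ℝ]) - w)).subset ?_)
    intro p hp
    refine ⟨(2 * p.re, normSq p), norm_trace_relations hw hp, ?_⟩
    simp only
    rw [← linear_of_quadratic hp, inv_mul_cancel_left₀ (hne p hp)]
  have hlin := linear_of_quadratic hp
  rw [h0, zero_mul, eq_comm, sub_eq_zero] at hlin
  have hw1 : w = 1 := by
    rw [← hlin, normSq_coe, pow_eq_one_iff_of_nonneg normSq_nonneg two_ne_zero] at hw
    rw [← hlin, hw, coe_one]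
  refine ⟨hw1, ?_⟩
  rw [hw1, one_mul] at h0
  have hi := congrArg (fun z : ℍ[ℝ] => z.imI) h0
  have hj := congrArg (fun z : ℍ[ℝ] => z.imJ) h0
  have hk := congrArg (fun z : ℍ[ℝ] => z.imK) h0
  simp at hi hj hk
  ext <;> simp <;> linarith

theorem infinite_left_spectrum_implies_rotation_form
    (A : Matrix (Fin 2) (Fin 2) ℍ[ℝ]) (hA : A * Aᴴ = 1)
    (hinf : {σ : ℍ[ℝ] | ∃ v : Fin 2 → ℍ[ℝ], v ≠ 0 ∧ A.mulVec v = σ • v}.Infinite) :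
    ∃ (q : ℍ[ℝ]) (θ : ℝ), ‖q‖ = 1 ∧ Real.sin θ ≠ 0 ∧
      A = !![q * (Real.cos θ : ℍ[ℝ]), -(q * (Real.sin θ : ℍ[ℝ]));
             q * (Real.sin θ : ℍ[ℝ]), q * (Real.cos θ : ℍ[ℝ])] := by
  obtain ⟨a, b, c, d, rfl⟩ : ∃ a b c d, A = !![a, b; c, d] := ⟨_, _, _, _, A.eta_fin_two⟩
  have h00 := congrFun₂ hA 0 0
  have h01 := congrFun₂ hA 0 1
  have h11 := congrFun₂ hA 1 1
  simp [Matrix.mul_apply, self_mul_star] at h00 h01 h11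
  replace h00 : normSq a + normSq b = 1 := by simpa using congrArg (·.re) h00
  replace h11 : normSq c + normSq d = 1 := by simpa using congrArg (·.re) h11
  have hprod : normSq a * normSq c = normSq b * normSq d := by
    simpa using congrArg normSq (eq_neg_of_add_eq_zero_left h01)
  have hbc : normSq c = normSq b := by
    linear_combination hprod - normSq c * h00 + normSq b * h11
  have hS : ∀ σ : ℍ[ℝ], (∃ v : Fin 2 → ℍ[ℝ], v ≠ 0 ∧ !![a, b; c, d].mulVec v = σ • v) →
      ∃ x y : ℍ[ℝ], (x ≠ 0 ∨ y ≠ 0) ∧ a * x + b * y = σ * x ∧ c * x + d * y = σ * y := by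
    rintro σ ⟨v, hv, h⟩
    refine ⟨v 0, v 1, ?_, ?_, ?_⟩
    · by_contra! h'
      exact hv (by ext i : 1; fin_cases i <;> simp [h'])
    · simpa [Matrix.mulVec, dotProduct] using congrFun h 0
    · simpa [Matrix.mulVec, dotProduct] using congrFun h 1
  have hb : b ≠ 0 := by
    rintro rfl
    have hc : c = 0 := by simpa using hbc
    subst hc
    refine hinf ((Set.toFinite {a, d}).subset fun σ hσ => ?_)
    obtain ⟨x, y, hxy, h1, h2⟩ := hS σ hσ
    rcases hxy with hx | hy
    · left; simpa [hx, eq_comm] using h1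
    · right; simpa [hy, eq_comm] using h2
  have hnb : normSq b ≠ 0 := by simpa using hb
  obtain ⟨u, rfl⟩ : ∃ u, a = b * u := ⟨b⁻¹ * a, by rw [mul_inv_cancel_left₀ hb]⟩
  obtain ⟨w, rfl⟩ : ∃ w, c = -(b * w) :=
    ⟨-(b⁻¹ * c), by rw [mul_neg, neg_neg, mul_inv_cancel_left₀ hb]⟩
  have hw : normSq w = 1 := by
    rw [normSq_neg, map_mul] at hbc
    exact mul_left_cancel₀ hnb (by rw [hbc, mul_one])
  have hd : d = b * (w * star u) := by
    have : b * star d = b * (u * star w * star b) := by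
      rw [eq_neg_of_add_eq_zero_right h01]
      simp [mul_assoc]
    have := congrArg star (mul_left_cancel₀ hb this)
    simpa [mul_assoc] using this
  subst hd
  obtain ⟨rfl, hu⟩ : w = 1 ∧ star u = u := by
    refine real_of_infinite_quadratic_solutions hw fun hfin => hinf ?_
    refine (hfin.image fun p => b * (u + p)).subset fun σ hσ => ?_
    obtain ⟨x, y, hxy, h1, h2⟩ := hS σ hσ
    have hx : x ≠ 0 := by
      rintro rfl
      simp [hb] at h1
      simp [h1] at hxy
    have hσ : σ = b * (u + y * x⁻¹) := by
      rw [← mul_inv_cancel_right₀ hx σ, ← h1, add_mul, mul_inv_cancel_right₀ hx, mul_add,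
        mul_assoc b y]
    refine ⟨y * x⁻¹, ?_, hσ.symm⟩
    obtain ⟨p, rfl⟩ : ∃ p, y = p * x := ⟨y * x⁻¹, by rw [inv_mul_cancel_right₀ hx]⟩
    rw [mul_inv_cancel_right₀ hx] at hσ ⊢
    have h3 : b * (p * p + (u - w * star u) * p + w) * x = 0 := by
      rw [hσ, ← sub_eq_zero] at h2
      rw [← neg_eq_zero, ← h2]
      noncomm_ring
    simpa [hb, hx] using h3
  obtain ⟨r, rfl⟩ : ∃ r : ℝ, u = (r : ℍ[ℝ]) := ⟨u.re, star_eq_self.1 hu⟩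
  have hbn : 0 < ‖b‖ := norm_pos_iff.2 hb
  have hsum : (r * ‖b‖) ^ 2 + ‖b‖ ^ 2 = 1 := by
    rw [map_mul, normSq_coe, normSq_eq_norm_mul_self] at h00
    linear_combination h00
  obtain ⟨θ, hcos, hsin⟩ : ∃ θ : ℝ, Real.cos θ = -(r * ‖b‖) ∧ Real.sin θ = ‖b‖ := by
    have hz : ‖(⟨-(r * ‖b‖), ‖b‖⟩ : ℂ)‖ = 1 := by
      rw [← sq_eq_sq₀ (norm_nonneg _) zero_le_one, Complex.sq_norm, Complex.normSq_mk]
      linear_combination hsum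
    have hz0 : (⟨-(r * ‖b‖), ‖b‖⟩ : ℂ) ≠ 0 := norm_ne_zero_iff.1 (by rw [hz]; exact one_ne_zero)
    exact ⟨Complex.arg ⟨-(r * ‖b‖), ‖b‖⟩, by rw [Complex.cos_arg hz0, hz, div_one],
      by rw [Complex.sin_arg, hz, div_one]⟩
  have hb' : b * ((‖b‖⁻¹ : ℝ) : ℍ[ℝ]) * ((‖b‖ : ℝ) : ℍ[ℝ]) = b := by
    rw [mul_assoc, ← coe_mul, inv_mul_cancel₀ hbn.ne', coe_one, mul_one]
  refine ⟨-(b * ((‖b‖⁻¹ : ℝ) : ℍ[ℝ])), θ, ?_, by rw [hsin]; exact hbn.ne', ?_⟩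
  · rw [norm_neg, norm_mul, norm_coe, norm_inv, norm_norm, mul_inv_cancel₀ hbn.ne']
  · have hc : -(b * ((‖b‖⁻¹ : ℝ) : ℍ[ℝ])) * ((-(r * ‖b‖) : ℝ) : ℍ[ℝ]) = b * (r : ℍ[ℝ]) := by
      rw [coe_neg, neg_mul_neg, mul_comm r, coe_mul, ← mul_assoc, hb']
    rw [hcos, hsin, hc, neg_mul, hb']
    simp
end

section
/- For every quaternion q with |q| = 1 and every real number θ with sin θ ≠ 0, the matrix A = [[q·cos θ, −q·sin θ], [q·sin θ, q·cos θ]] is symplectic and has infinitely many left eigenvalues. -/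
open Quaternion Matrix

theorem Quaternion.mul_star_eq_one_of_norm_eq_one (q : ℍ[ℝ]) (hq : ‖q‖ = 1) :
    q * star q = 1 := by
  rw [Quaternion.self_mul_star, Quaternion.normSq_eq_norm_mul_self, hq]
  simp

/-- Quaternions `q * (s * x + c)` with `x * x = -1` are left eigenvalues of the matrix
`!![q * c, -(q * s); q * s, q * c]`, with eigenvector `![x, 1]`. -/
theorem Quaternion.mulVec_rotation_eq_smul (q x : ℍ[ℝ]) (hx : x * x = -1) (c s : ℝ) :
    !![q * (c : ℍ[ℝ]), -(q * (s : ℍ[ℝ])); q * (s : ℍ[ℝ]), q * (c : ℍ[ℝ])].mulVec ![x, 1] =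
      (q * ((s : ℍ[ℝ]) * x + (c : ℍ[ℝ]))) • ![x, 1] := by
  ext1 i
  fin_cases i
  · simp [Matrix.mulVec, dotProduct, Fin.sum_univ_two, mul_add, add_mul, mul_assoc, hx, add_comm]
  · simp [Matrix.mulVec, dotProduct, Fin.sum_univ_two, mul_add, mul_assoc]

theorem Quaternion.mul_self_eq_neg_one_of_re_eq_zero (x : ℍ[ℝ]) (hre : x.re = 0)
    (him : x.imI * x.imI + x.imJ * x.imJ + x.imK * x.imK = 1) : x * x = -1 := by
  ext
  · simp [hre]
    linarith
  all_goals
    simp [hre]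
    try ring

theorem Quaternion.infinite_setOf_mul_self_eq_neg_one : {x : ℍ[ℝ] | x * x = -1}.Infinite := by
  refine Set.infinite_of_injOn_mapsTo (s := Set.Icc (-1 : ℝ) 1)
    (f := fun t : ℝ => (⟨0, t, Real.sqrt (1 - t ^ 2), 0⟩ : ℍ[ℝ])) ?_ ?_
    (Set.Icc_infinite (by norm_num))
  · intro a _ b _ h
    exact congrArg QuaternionAlgebra.imI h
  · intro t ht
    have h : Real.sqrt (1 - t ^ 2) * Real.sqrt (1 - t ^ 2) = 1 - t ^ 2 :=
      Real.mul_self_sqrt (by nlinarith [ht.1, ht.2])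
    exact Quaternion.mul_self_eq_neg_one_of_re_eq_zero _ rfl (by
      change t * t + Real.sqrt (1 - t ^ 2) * Real.sqrt (1 - t ^ 2) + 0 * 0 = 1
      rw [h]
      ring)

theorem rotation_form_is_symplectic_with_infinite_left_spectrum
    (q : ℍ[ℝ]) (hq : ‖q‖ = 1) (θ : ℝ) (hθ : Real.sin θ ≠ 0)
    (A : Matrix (Fin 2) (Fin 2) ℍ[ℝ])
    (hA : A = !![q * (Real.cos θ : ℍ[ℝ]), -(q * (Real.sin θ : ℍ[ℝ]));
                 q * (Real.sin θ : ℍ[ℝ]), q * (Real.cos θ : ℍ[ℝ])]) :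
    A * Aᴴ = 1 ∧
    {σ : ℍ[ℝ] | ∃ v : Fin 2 → ℍ[ℝ], v ≠ 0 ∧ A.mulVec v = σ • v}.Infinite := by
  have hqq := Quaternion.mul_star_eq_one_of_norm_eq_one q hq
  have hq0 : q ≠ 0 := by
    rintro rfl
    simp at hq
  subst hA
  constructor
  · have hcs (a b : ℝ) : q * (a : ℍ[ℝ]) * (b * star q) = ((a * b : ℝ) : ℍ[ℝ]) := by
      rw [← mul_assoc, mul_assoc q, ← Quaternion.coe_mul, ← Quaternion.coe_commutes,
        mul_assoc, hqq, mul_one]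
    have h1 : Real.cos θ * Real.cos θ + Real.sin θ * Real.sin θ = 1 := by
      rw [← sq, ← sq, Real.cos_sq_add_sin_sq]
    ext1 i j
    fin_cases i <;> fin_cases j <;>
      simp only [Matrix.mul_apply, Fin.sum_univ_two, Matrix.conjTranspose_apply] <;>
      simp [-Quaternion.coe_mul, hcs, ← Quaternion.coe_add, h1,
        add_comm, mul_comm (Real.sin θ) (Real.cos θ)]
  · refine Set.infinite_of_injOn_mapsTo
      (f := fun x : ℍ[ℝ] => q * ((Real.sin θ : ℍ[ℝ]) * x + (Real.cos θ : ℍ[ℝ]))) ?_ ?_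
      Quaternion.infinite_setOf_mul_self_eq_neg_one
    · intro x _ y _ h
      have hs : (Real.sin θ : ℍ[ℝ]) ≠ 0 := by
        rw [← Quaternion.coe_zero]
        exact fun h => hθ (Quaternion.coe_injective h)
      exact mul_left_cancel₀ hs (add_right_cancel (mul_left_cancel₀ hq0 h))
    · intro x hx
      refine ⟨![x, 1], fun h => one_ne_zero (congrFun h 1), ?_⟩
      exact Quaternion.mulVec_rotation_eq_smul q x hx _ _
end

section
/- Let A be a 2×2 symplectic quaternionic matrix that is not of the form [[q·cos θ, −q·sin θ], [q·sin θ, q·cos θ]] for some quaternion q with |q| = 1 and real θ with sin θ ≠ 0. Then the set of left eigenvalues of A is nonempty and has at most two elements. -/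
open Quaternion Matrix

theorem Quaternion.mul_self_eq (t : ℍ[ℝ]) :
    t * t = ((2 * t.re : ℝ) : ℍ[ℝ]) * t - ((normSq t : ℝ) : ℍ[ℝ]) := by
  rw [← Quaternion.star_mul_self, Quaternion.star_eq_two_re_sub]
  noncomm_ring

/-- A monic quadratic polynomial with quaternionic coefficients has a root. -/
theorem Quaternion.exists_root_quadratic (p q : ℍ[ℝ]) :
    ∃ t : ℍ[ℝ], t * t + p * t + q = 0 := by
  obtain ⟨z, hz⟩ : ∃ z : ℂ, z ^ 4 + ((2 * p.re : ℝ) : ℂ) * z ^ 3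
      + ((normSq p + 2 * q.re : ℝ) : ℂ) * z ^ 2
      + ((2 * (p * star q).re : ℝ) : ℂ) * z + ((normSq q : ℝ) : ℂ) = 0 := by
    have hdeg : (Polynomial.X ^ 4 + Polynomial.C ((2 * p.re : ℝ) : ℂ) * Polynomial.X ^ 3
        + Polynomial.C ((normSq p + 2 * q.re : ℝ) : ℂ) * Polynomial.X ^ 2
        + Polynomial.C ((2 * (p * star q).re : ℝ) : ℂ) * Polynomial.X
        + Polynomial.C ((normSq q : ℝ) : ℂ)).degree = 4 := by
      compute_degree!
    obtain ⟨z, hz⟩ := Complex.exists_root (by rw [hdeg]; norm_num)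
    exact ⟨z, by simpa [Polynomial.IsRoot] using hz⟩
  obtain ⟨r, y⟩ := z
  rw [Complex.ext_iff] at hz
  obtain ⟨hre, him⟩ := hz
  simp only [pow_succ, pow_zero, one_mul, Complex.add_re, Complex.add_im, Complex.mul_re,
    Complex.mul_im, Complex.ofReal_re, Complex.ofReal_im, Complex.zero_re, Complex.zero_im]
    at hre him
  by_cases hy : y = 0
  · subst hy
    refine ⟨(r : ℍ[ℝ]), ?_⟩
    rw [← Quaternion.normSq_eq_zero]
    simp only [Quaternion.normSq_def', Quaternion.re_mul, Quaternion.imI_mul, Quaternion.imJ_mul,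
      Quaternion.imK_mul, Quaternion.re_add, Quaternion.imI_add, Quaternion.imJ_add,
      Quaternion.imK_add, Quaternion.re_coe, Quaternion.imI_coe, Quaternion.imJ_coe,
      Quaternion.imK_coe, Quaternion.re_star, Quaternion.imI_star, Quaternion.imJ_star,
      Quaternion.imK_star] at hre ⊢
    linear_combination hre
  set n : ℝ := r ^ 2 + y ^ 2 with hn
  set u : ℍ[ℝ] := p + ((2 * r : ℝ) : ℍ[ℝ]) with hu
  set w : ℍ[ℝ] := (n : ℍ[ℝ]) - q with hw
  have hβ : (star u * w).re = r * normSq u := by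
    refine mul_left_cancel₀ (mul_ne_zero two_ne_zero hy) ?_
    simp only [hu, hw, hn, Quaternion.normSq_def', Quaternion.re_mul, Quaternion.re_add,
      Quaternion.imI_add, Quaternion.imJ_add, Quaternion.imK_add, Quaternion.re_sub,
      Quaternion.imI_sub, Quaternion.imJ_sub, Quaternion.imK_sub, Quaternion.re_coe,
      Quaternion.imI_coe, Quaternion.imJ_coe, Quaternion.imK_coe, Quaternion.re_star,
      Quaternion.imI_star, Quaternion.imJ_star, Quaternion.imK_star] at him ⊢
    linear_combination -him
  have hγ : normSq w = n * normSq u := by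
    refine mul_left_cancel₀ hy ?_
    simp only [hu, hw, hn, Quaternion.normSq_def', Quaternion.re_mul, Quaternion.re_add,
      Quaternion.imI_add, Quaternion.imJ_add, Quaternion.imK_add, Quaternion.re_sub,
      Quaternion.imI_sub, Quaternion.imJ_sub, Quaternion.imK_sub, Quaternion.re_coe,
      Quaternion.imI_coe, Quaternion.imJ_coe, Quaternion.imK_coe, Quaternion.re_star,
      Quaternion.imI_star, Quaternion.imJ_star, Quaternion.imK_star] at hre him ⊢
    linear_combination y * hre - r * him
  by_cases hu0 : u = 0
  · have hw0 : w = 0 := by simpa [hu0] using hγ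
    have hp : p = -((2 * r : ℝ) : ℍ[ℝ]) := eq_neg_of_add_eq_zero_left hu0
    have hq : q = (n : ℍ[ℝ]) := (sub_eq_zero.mp hw0).symm
    obtain ⟨t, htr, htn⟩ : ∃ t : ℍ[ℝ], t.re = r ∧ normSq t = n :=
      ⟨⟨r, y, 0, 0⟩, rfl, (Quaternion.normSq_def' _).trans (by simp [hn])⟩
    refine ⟨t, ?_⟩
    rw [hp, hq, Quaternion.mul_self_eq, htr, htn]
    noncomm_ring
  · have hN : normSq u ≠ 0 := Quaternion.normSq_ne_zero.mpr hu0
    obtain ⟨t, ht⟩ : ∃ t, u * t = w := ⟨u⁻¹ * w, mul_inv_cancel_left₀ hu0 w⟩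
    have htn : normSq t = n := by
      rw [← ht, map_mul, mul_comm n] at hγ
      exact mul_left_cancel₀ hN hγ
    have htr : t.re = r := by
      rw [← ht, ← mul_assoc, Quaternion.star_mul_self, Quaternion.coe_mul_eq_smul,
        Quaternion.re_smul, smul_eq_mul, mul_comm r] at hβ
      exact mul_left_cancel₀ hN hβ
    refine ⟨t, ?_⟩
    rw [Quaternion.mul_self_eq, htn, htr]
    rw [hu, hw, add_mul] at ht
    calc _ = (p * t + ((2 * r : ℝ) : ℍ[ℝ]) * t) - ((n : ℍ[ℝ]) - q) := by abel
      _ = 0 := by rw [ht, sub_self]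

theorem Quaternion.re_mul_comm (a b : ℍ[ℝ]) : (a * b).re = (b * a).re := by
  simp only [Quaternion.re_mul]
  ring

/-- The inverse of the difference of two roots of a monic quadratic solves a Sylvester equation. -/
theorem sylvester_of_roots {p q s t : ℍ[ℝ]} (hs : s * s + p * s + q = 0)
    (ht : t * t + p * t + q = 0) (hst : t ≠ s) :
    s * (t - s)⁻¹ + (t - s)⁻¹ * (s + p) = -1 := by
  have h0 : t - s ≠ 0 := sub_ne_zero.mpr hst
  set h := t - s with hh
  have htt : t = s + h := by rw [hh]; abel
  have key : h * h + h * s + (s + p) * h = 0 := by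
    rw [htt] at ht
    calc _ = ((s + h) * (s + h) + p * (s + h) + q) - (s * s + p * s + q) := by noncomm_ring
      _ = 0 := by rw [hs, ht, sub_zero]
  have := congrArg (fun x => h⁻¹ * x * h⁻¹) key
  simp only [mul_add, add_mul, mul_zero, zero_mul, mul_assoc, mul_inv_cancel₀ h0, mul_one,
    inv_mul_cancel_left₀ h0] at this
  rw [mul_add, ← sub_eq_zero, ← this]
  abel

/-- If the Sylvester equation `s k + k m = -1` has two solutions, then `m = -star s`. -/
theorem sylvester_eq_neg_star {s m k l : ℍ[ℝ]} (hk : s * k + k * m = -1)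
    (hl : s * l + l * m = -1) (hkl : k ≠ l) : m = -star s := by
  have he : k - l ≠ 0 := sub_ne_zero.mpr hkl
  have hconj : s * (k - l) = -((k - l) * m) := by
    rw [← sub_eq_zero]
    calc _ = (s * k + k * m) - (s * l + l * m) := by noncomm_ring
      _ = 0 := by rw [hk, hl, sub_self]
  have hm : m = -((k - l)⁻¹ * (s * (k - l))) := by
    rw [hconj, mul_neg, neg_neg, inv_mul_cancel_left₀ he]
  have hre : m.re = -s.re := by
    rw [hm, Quaternion.re_neg, Quaternion.re_mul_comm, mul_assoc, mul_inv_cancel₀ he, mul_one]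
  have hn : normSq m = normSq s := by
    have := congrArg normSq hconj
    rw [Quaternion.normSq_neg, map_mul, map_mul, mul_comm] at this
    exact (mul_left_cancel₀ (Quaternion.normSq_ne_zero.mpr he) this).symm
  have hsm : star m = -((2 * s.re : ℝ) : ℍ[ℝ]) - m := by
    rw [Quaternion.star_eq_two_re_sub, hre, mul_neg, Quaternion.coe_neg]
  have hmm : m * star m = ((normSq s : ℝ) : ℍ[ℝ]) := by rw [Quaternion.self_mul_star, hn]
  have hc := Quaternion.coe_commutes (2 * s.re) k
  have hc' := Quaternion.coe_commutes (normSq s) k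
  have hzero : s * (s * k + k * m) + (s * k + k * m) * star m = 0 := by
    calc _ = (s * s) * k + s * k * (m + star m) + k * (m * star m) := by noncomm_ring
      _ = (((2 * s.re : ℝ) : ℍ[ℝ]) * s - ((normSq s : ℝ) : ℍ[ℝ])) * k
          - s * (((2 * s.re : ℝ) : ℍ[ℝ]) * k) + ((normSq s : ℝ) : ℍ[ℝ]) * k := by
        rw [hmm, hsm, Quaternion.mul_self_eq, hc, hc']
        noncomm_ring
      _ = 0 := by
        rw [Quaternion.coe_commutes]
        noncomm_ring
  rw [hk, mul_neg, mul_one, neg_mul, one_mul] at hzero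
  have : star m = -s := by
    rw [← sub_eq_zero, ← neg_eq_zero, ← hzero]
    abel
  rw [← star_star m, this, star_neg]

/-- A monic quadratic with three distinct roots has real coefficients. -/
theorem coeffs_of_three_roots {p q s t t' : ℍ[ℝ]} (hs : s * s + p * s + q = 0)
    (ht : t * t + p * t + q = 0) (ht' : t' * t' + p * t' + q = 0)
    (hts : t ≠ s) (hts' : t' ≠ s) (htt' : t ≠ t') :
    p = ((-(2 * s.re) : ℝ) : ℍ[ℝ]) ∧ q = ((normSq s : ℝ) : ℍ[ℝ]) := by
  have hm : s + p = -star s := by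
    refine sylvester_eq_neg_star (sylvester_of_roots hs ht hts) (sylvester_of_roots hs ht' hts') ?_
    intro h
    exact htt' (sub_left_injective (inv_injective h))
  constructor
  · rw [eq_sub_of_add_eq' hm, Quaternion.star_eq_two_re_sub, Quaternion.coe_neg]
    abel
  · rw [← Quaternion.star_mul_self, ← sub_eq_zero, ← hs]
    have : star s = -(s + p) := by rw [hm, neg_neg]
    rw [this]
    noncomm_ring

/-- If `b ≠ 0`, the left eigenvalues of `!![a, b; c, d]` are the `a + b t` with `t` a root of
an associated quadratic. -/
theorem left_eigenvalue_iff {a b c d : ℍ[ℝ]} (hb : b ≠ 0) (σ : ℍ[ℝ]) :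
    (∃ v : Fin 2 → ℍ[ℝ], v ≠ 0 ∧ (!![a, b; c, d]).mulVec v = σ • v) ↔
      ∃ t, t * t + b⁻¹ * (a - d) * t + -(b⁻¹ * c) = 0 ∧ σ = a + b * t := by
  have hquad : ∀ t : ℍ[ℝ], t * t + b⁻¹ * (a - d) * t + -(b⁻¹ * c) = 0 ↔
      c + d * t = (a + b * t) * t := by
    intro t
    have : t * t + b⁻¹ * (a - d) * t + -(b⁻¹ * c)
        = b⁻¹ * ((a + b * t) * t - (c + d * t)) := by
      have h : t * t = b⁻¹ * (b * t * t) := by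
        rw [mul_assoc, inv_mul_cancel_left₀ hb]
      rw [h]
      noncomm_ring
    rw [this, mul_eq_zero_iff_left (inv_ne_zero hb), sub_eq_zero, eq_comm]
  constructor
  · rintro ⟨v, hv, h⟩
    have h0 : a * v 0 + b * v 1 = σ * v 0 := by
      simpa [Matrix.mulVec, dotProduct, Fin.sum_univ_two] using congrFun h 0
    have h1 : c * v 0 + d * v 1 = σ * v 1 := by
      simpa [Matrix.mulVec, dotProduct, Fin.sum_univ_two] using congrFun h 1
    have hx : v 0 ≠ 0 := by
      intro hx
      rw [hx, mul_zero, mul_zero, zero_add] at h0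
      apply hv
      funext i
      fin_cases i
      · exact hx
      · exact (mul_eq_zero.mp h0).resolve_left hb
    have hσ : σ = a + b * (v 1 * (v 0)⁻¹) := by
      have := congrArg (· * (v 0)⁻¹) h0
      simp only [add_mul, mul_assoc, mul_inv_cancel₀ hx, mul_one] at this
      exact this.symm
    refine ⟨v 1 * (v 0)⁻¹, ?_, hσ⟩
    rw [hquad, ← hσ]
    have := congrArg (· * (v 0)⁻¹) h1
    simpa only [add_mul, mul_assoc, mul_inv_cancel₀ hx, mul_one] using this
  · rintro ⟨t, ht, rfl⟩
    rw [hquad] at ht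
    refine ⟨![1, t], fun h => one_ne_zero (congrFun h 0), ?_⟩
    funext i
    fin_cases i
    · simp [Matrix.mulVec, dotProduct, Fin.sum_univ_two]
    · simpa [Matrix.mulVec, dotProduct, Fin.sum_univ_two] using ht

/-- A symplectic matrix whose eigenvector quadratic is `t² + x t + n` with real `x` and `n` has
the shape of a quaternion times a plane rotation. -/
theorem exists_rotation_form {a b c d : ℍ[ℝ]} {x n : ℝ} (hb : b ≠ 0)
    (h00 : normSq a + normSq b = 1) (h11 : normSq c + normSq d = 1)
    (h01 : a * star c + b * star d = 0)
    (hp : b⁻¹ * (a - d) = (x : ℍ[ℝ])) (hq : -(b⁻¹ * c) = (n : ℍ[ℝ])) (hn : 0 ≤ n) :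
    ∃ (q : ℍ[ℝ]) (θ : ℝ), ‖q‖ = 1 ∧ Real.sin θ ≠ 0 ∧
      !![a, b; c, d] = !![q * (Real.cos θ : ℍ[ℝ]), -(q * (Real.sin θ : ℍ[ℝ]));
             q * (Real.sin θ : ℍ[ℝ]), q * (Real.cos θ : ℍ[ℝ])] := by
  have hB : 0 < normSq b := lt_of_le_of_ne Quaternion.normSq_nonneg
    (Quaternion.normSq_ne_zero.mpr hb).symm
  have hc : c = -(b * n) := by rw [← hq, mul_neg, neg_neg, mul_inv_cancel_left₀ hb]
  have hd : d = a - b * x := by rw [← hp, mul_inv_cancel_left₀ hb]; abel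
  have hcb : normSq c = normSq b := by
    have h : normSq a * normSq c = normSq b * normSq d := by
      have := congrArg normSq (eq_neg_of_add_eq_zero_left h01)
      simpa only [map_mul, Quaternion.normSq_neg, Quaternion.normSq_star] using this
    linear_combination -normSq c * h00 + normSq b * h11 + h
  have hn1 : n = 1 := by
    rw [hc, Quaternion.normSq_neg, map_mul, Quaternion.normSq_coe] at hcb
    have : n ^ 2 = 1 := mul_left_cancel₀ hB.ne' (by rw [hcb, mul_one])
    nlinarith
  subst hn1
  rw [Quaternion.coe_one, mul_one] at hc
  subst hc hd
  have hx : x = 0 := by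
    have h := congrArg (fun t : ℍ[ℝ] => t.re) h01
    simp only [Quaternion.re_add, Quaternion.re_mul, Quaternion.re_star, Quaternion.imI_star,
      Quaternion.imJ_star, Quaternion.imK_star, Quaternion.re_neg, Quaternion.imI_neg,
      Quaternion.imJ_neg, Quaternion.imK_neg, Quaternion.re_sub, Quaternion.imI_sub,
      Quaternion.imJ_sub, Quaternion.imK_sub, Quaternion.imI_mul, Quaternion.imJ_mul,
      Quaternion.imK_mul, Quaternion.re_coe, Quaternion.imI_coe, Quaternion.imJ_coe,
      Quaternion.imK_coe, Quaternion.re_zero] at h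
    refine (mul_eq_zero.mp ?_).resolve_left hB.ne'
    rw [Quaternion.normSq_def']
    linear_combination -h
  subst hx
  simp only [Quaternion.coe_zero, mul_zero, sub_zero] at h01 ⊢
  have hreal : ((a * star b).re : ℍ[ℝ]) = a * star b := by
    refine (Quaternion.star_eq_self.mp ?_).symm
    rw [star_mul, star_star, ← sub_eq_zero, ← h01, star_neg]
    noncomm_ring
  obtain ⟨l, rfl⟩ : ∃ l : ℝ, a = l * b := by
    refine ⟨(a * star b).re / normSq b, ?_⟩
    have hB' : ((normSq b : ℝ) : ℍ[ℝ]) ≠ 0 := by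
      rw [Ne, ← Quaternion.coe_zero, Quaternion.coe_inj]
      exact hB.ne'
    rw [div_eq_inv_mul, Quaternion.coe_mul, hreal, mul_assoc, mul_assoc, Quaternion.star_mul_self,
      ← Quaternion.coe_commutes, ← mul_assoc, ← Quaternion.coe_mul, inv_mul_cancel₀ hB.ne',
      Quaternion.coe_one, one_mul]
  rw [map_mul, Quaternion.normSq_coe] at h00
  have hb' : ‖b‖ ≠ 0 := norm_ne_zero_iff.mpr hb
  rw [Quaternion.normSq_eq_norm_mul_self] at h00
  obtain ⟨θ, hcos, hsin⟩ : ∃ θ : ℝ, Real.cos θ = -(l * ‖b‖) ∧ Real.sin θ = ‖b‖ := by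
    have h1 : ‖(⟨-(l * ‖b‖), ‖b‖⟩ : ℂ)‖ = 1 := by
      rw [Complex.norm_def, Real.sqrt_eq_one, Complex.normSq_mk]
      linear_combination h00
    have h0 : (⟨-(l * ‖b‖), ‖b‖⟩ : ℂ) ≠ 0 := norm_ne_zero_iff.mp (h1 ▸ one_ne_zero)
    refine ⟨Complex.arg ⟨-(l * ‖b‖), ‖b‖⟩, ?_, ?_⟩
    · rw [Complex.cos_arg h0, h1, div_one]
    · rw [Complex.sin_arg, h1, div_one]
  have hs : (-(b * ((‖b‖⁻¹ : ℝ) : ℍ[ℝ]))) * (‖b‖ : ℍ[ℝ]) = -b := by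
    rw [neg_mul, mul_assoc, ← Quaternion.coe_mul, inv_mul_cancel₀ hb', Quaternion.coe_one, mul_one]
  have hc : (-(b * ((‖b‖⁻¹ : ℝ) : ℍ[ℝ]))) * ((-(l * ‖b‖) : ℝ) : ℍ[ℝ]) = l * b := by
    rw [neg_mul, mul_assoc, ← Quaternion.coe_mul, Quaternion.coe_commutes, ← mul_neg,
      ← Quaternion.coe_neg]
    congr 2
    field_simp
  refine ⟨-(b * ((‖b‖⁻¹ : ℝ) : ℍ[ℝ])), θ, ?_, hsin ▸ hb', ?_⟩
  · rw [norm_neg, norm_mul, Quaternion.norm_coe, norm_inv, norm_norm, mul_inv_cancel₀ hb']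
  · rw [hcos, hsin, hs, hc, neg_neg]

theorem left_spectrum_nonempty_and_at_most_two
    (A : Matrix (Fin 2) (Fin 2) ℍ[ℝ]) (hA : A * Aᴴ = 1)
    (hnot : ¬ ∃ (q : ℍ[ℝ]) (θ : ℝ), ‖q‖ = 1 ∧ Real.sin θ ≠ 0 ∧
      A = !![q * (Real.cos θ : ℍ[ℝ]), -(q * (Real.sin θ : ℍ[ℝ]));
             q * (Real.sin θ : ℍ[ℝ]), q * (Real.cos θ : ℍ[ℝ])]) :
    {σ : ℍ[ℝ] | ∃ v : Fin 2 → ℍ[ℝ], v ≠ 0 ∧ A.mulVec v = σ • v}.Nonempty ∧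
    ∃ a b : ℍ[ℝ],
      {σ : ℍ[ℝ] | ∃ v : Fin 2 → ℍ[ℝ], v ≠ 0 ∧ A.mulVec v = σ • v} ⊆ {a, b} := by
  obtain ⟨a, b, c, d, rfl⟩ : ∃ a b c d, A = !![a, b; c, d] :=
    ⟨_, _, _, _, Matrix.eta_fin_two A⟩
  have h00 : normSq a + normSq b = 1 := by
    have := congrFun (congrFun hA 0) 0
    simp only [Matrix.mul_apply, Fin.sum_univ_two, Matrix.conjTranspose_apply] at this
    simp only [Matrix.of_apply, Matrix.cons_val', Matrix.cons_val_zero, Matrix.cons_val_one,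
      Matrix.one_apply_eq, Quaternion.self_mul_star] at this
    rw [← Quaternion.coe_add, ← Quaternion.coe_one] at this
    exact Quaternion.coe_injective this
  have h11 : normSq c + normSq d = 1 := by
    have := congrFun (congrFun hA 1) 1
    simp only [Matrix.mul_apply, Fin.sum_univ_two, Matrix.conjTranspose_apply] at this
    simp only [Matrix.of_apply, Matrix.cons_val', Matrix.cons_val_zero, Matrix.cons_val_one,
      Matrix.one_apply_eq, Quaternion.self_mul_star] at this
    rw [← Quaternion.coe_add, ← Quaternion.coe_one] at this
    exact Quaternion.coe_injective this
  have h01 : a * star c + b * star d = 0 := by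
    simpa [Matrix.mul_apply, Fin.sum_univ_two] using congrFun (congrFun hA 0) 1
  by_cases hb : b = 0
  · subst hb
    have ha : a ≠ 0 := by
      rintro rfl
      simp at h00
    have hc : c = 0 := by simpa [ha] using h01
    subst hc
    refine ⟨⟨a, ![1, 0], fun h => one_ne_zero (congrFun h 0), ?_⟩, a, d, ?_⟩
    · funext i
      fin_cases i <;> simp [Matrix.mulVec, dotProduct, Fin.sum_univ_two]
    · rintro σ ⟨v, hv, h⟩
      have h0 : a = σ ∨ v 0 = 0 := by
        simpa [Matrix.mulVec, dotProduct, Fin.sum_univ_two] using congrFun h 0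
      have h1 : d = σ ∨ v 1 = 0 := by
        simpa [Matrix.mulVec, dotProduct, Fin.sum_univ_two] using congrFun h 1
      rcases h0 with h0 | h0
      · exact Or.inl h0.symm
      rcases h1 with h1 | h1
      · exact Or.inr h1.symm
      refine absurd ?_ hv
      funext i
      fin_cases i
      · exact h0
      · exact h1
  simp only [left_eigenvalue_iff hb]
  obtain ⟨s, hs⟩ := Quaternion.exists_root_quadratic (b⁻¹ * (a - d)) (-(b⁻¹ * c))
  refine ⟨⟨a + b * s, s, hs, rfl⟩, ?_⟩
  by_cases h : ∃ t, t * t + b⁻¹ * (a - d) * t + -(b⁻¹ * c) = 0 ∧ t ≠ s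
  · obtain ⟨t, ht, hts⟩ := h
    refine ⟨a + b * s, a + b * t, ?_⟩
    rintro _ ⟨t', ht', rfl⟩
    by_cases hts' : t' = s
    · exact Or.inl (by rw [hts'])
    by_cases htt' : t = t'
    · exact Or.inr (by rw [htt']; rfl)
    obtain ⟨hp, hq⟩ := coeffs_of_three_roots hs ht ht' hts hts' htt'
    exact absurd (exists_rotation_form hb h00 h11 h01 hp hq Quaternion.normSq_nonneg) hnot
  · refine ⟨a + b * s, a + b * s, ?_⟩
    rintro _ ⟨t, ht, rfl⟩
    have hts : t = s := by
      by_contra hts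
      exact h ⟨t, ht, hts⟩
    exact Or.inl (by rw [hts])
end

section
/- Let q be a quaternion with |q| = 1, let θ be a real number with sin θ ≠ 0, and let A = [[q·cos θ, −q·sin θ], [q·sin θ, q·cos θ]]. A quaternion σ is a left eigenvalue of A if and only if σ = q·(cos θ + sin θ·ω) for some purely imaginary quaternion ω with |ω| = 1. -/
open Quaternion Matrix

theorem Quaternion.sq_eq_neg_one_iff (ω : ℍ[ℝ]) : ω ^ 2 = -1 ↔ ω.re = 0 ∧ ‖ω‖ = 1 := by
  constructor
  · intro h
    have hn : ‖ω‖ = 1 := by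
      have : ‖ω‖ ^ 2 = 1 := by rw [← norm_pow, h, norm_neg, norm_one]
      exact (pow_eq_one_iff_of_nonneg (norm_nonneg ω) two_ne_zero).1 this
    refine ⟨Quaternion.sq_eq_neg_normSq.1 ?_, hn⟩
    rw [h, Quaternion.normSq_eq_norm_mul_self, hn]
    simp
  · rintro ⟨hr, hn⟩
    rw [Quaternion.sq_eq_neg_normSq.2 hr, Quaternion.normSq_eq_norm_mul_self, hn]
    simp

theorem left_eigenvalue_iff_q_mul_cos_add_sin_omega
    (q : ℍ[ℝ]) (hq : ‖q‖ = 1) (θ : ℝ) (hθ : Real.sin θ ≠ 0)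
    (A : Matrix (Fin 2) (Fin 2) ℍ[ℝ])
    (hA : A = !![q * (Real.cos θ : ℍ[ℝ]), -(q * (Real.sin θ : ℍ[ℝ]));
                 q * (Real.sin θ : ℍ[ℝ]), q * (Real.cos θ : ℍ[ℝ])])
    (σ : ℍ[ℝ]) :
    (∃ v : Fin 2 → ℍ[ℝ], v ≠ 0 ∧ A.mulVec v = σ • v) ↔
    ∃ ω : ℍ[ℝ], ω.re = 0 ∧ ‖ω‖ = 1 ∧
      σ = q * ((Real.cos θ : ℍ[ℝ]) + (Real.sin θ : ℍ[ℝ]) * ω) := by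
  have hq0 : q ≠ 0 := norm_ne_zero_iff.1 (by simp [hq])
  subst hA
  generalize Real.cos θ = c
  generalize Real.sin θ = s at hθ ⊢
  have hs : (s : ℍ[ℝ]) ≠ 0 := by
    rwa [← Quaternion.coe_zero, Ne, Quaternion.coe_inj]
  have hσ : σ = q * ((c : ℍ[ℝ]) + (s : ℍ[ℝ]) * ((s : ℍ[ℝ])⁻¹ * (q⁻¹ * σ - c))) := by
    rw [mul_inv_cancel_left₀ hs, add_sub_cancel, mul_inv_cancel_left₀ hq0]
  have key : ∀ ω : ℍ[ℝ], σ = q * ((c : ℍ[ℝ]) + (s : ℍ[ℝ]) * ω) → ∀ v : Fin 2 → ℍ[ℝ],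
      (!![q * (c : ℍ[ℝ]), -(q * (s : ℍ[ℝ])); q * (s : ℍ[ℝ]), q * (c : ℍ[ℝ])].mulVec v = σ • v ↔
        ω * v 0 = -v 1 ∧ ω * v 1 = v 0) := by
    rintro ω rfl v
    have hqs : q * (s : ℍ[ℝ]) ≠ 0 := mul_ne_zero hq0 hs
    have h0 : q * c * v 0 + -(q * s) * v 1 = q * (c + s * ω) * v 0 ↔ ω * v 0 = -v 1 := by
      have e : q * c * v 0 + -(q * s) * v 1 - q * (c + s * ω) * v 0
          = q * s * (-v 1 - ω * v 0) := by noncomm_ring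
      rw [← sub_eq_zero, e, mul_eq_zero, or_iff_right hqs, sub_eq_zero, eq_comm]
    have h1 : q * s * v 0 + q * c * v 1 = q * (c + s * ω) * v 1 ↔ ω * v 1 = v 0 := by
      have e : q * s * v 0 + q * c * v 1 - q * (c + s * ω) * v 1
          = q * s * (v 0 - ω * v 1) := by noncomm_ring
      rw [← sub_eq_zero, e, mul_eq_zero, or_iff_right hqs, sub_eq_zero, eq_comm]
    rw [← h0, ← h1, funext_iff, Fin.forall_fin_two]
    simp [Matrix.mulVec, dotProduct, Fin.sum_univ_two]
  constructor
  · rintro ⟨v, hv, h⟩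
    refine ⟨_, and_assoc.1 ⟨(Quaternion.sq_eq_neg_one_iff _).1 ?_, hσ⟩⟩
    obtain ⟨h0, h1⟩ := (key _ hσ v).1 h
    generalize (s : ℍ[ℝ])⁻¹ * (q⁻¹ * σ - c) = ω at h0 h1
    have hv1 : v 1 ≠ 0 := by
      intro hv1
      refine hv (funext (Fin.forall_fin_two.2 ⟨?_, hv1⟩))
      rw [← h1, hv1, mul_zero, Pi.zero_apply]
    apply mul_right_cancel₀ hv1
    rw [sq, mul_assoc, h1, h0, neg_one_mul]
  · rintro ⟨ω, hr, hn, h⟩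
    refine ⟨![1, -ω], fun hv => one_ne_zero (congrFun hv 0), (key ω h _).2 ?_⟩
    have := (Quaternion.sq_eq_neg_one_iff ω).2 ⟨hr, hn⟩
    simp [← sq, this]
end

section
/- Let q be a quaternion with |q| = 1, let θ be a real number with sin θ ≠ 0, and let A = [[q·cos θ, −q·sin θ], [q·sin θ, q·cos θ]]. A quaternion σ is a left eigenvalue of A if and only if |σ| = 1 and the real part of q̄·σ equals cos θ, where q̄ is the conjugate of q. -/
open Quaternion Matrix

/-- A quaternion squares to the negative of a nonzero real square iff it is purely imaginary
of the corresponding norm. -/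
lemma Quaternion.mul_self_eq_neg_coe_sq_iff {s : ℝ} (hs : s ≠ 0) (u : ℍ[ℝ]) :
    u * u = -((s : ℍ[ℝ]) * (s : ℍ[ℝ])) ↔ u.re = 0 ∧ normSq u = s ^ 2 := by
  have hs2 : 0 < s ^ 2 := by positivity
  rw [normSq_def', Quaternion.ext_iff]
  simp only [re_mul, imI_mul, imJ_mul, imK_mul, re_neg, imI_neg, imJ_neg, imK_neg, re_coe,
    imI_coe, imJ_coe, imK_coe]
  constructor
  · rintro ⟨h0, h1, h2, h3⟩
    have hre : u.re = 0 := by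
      by_contra hne
      have hi : u.imI = 0 := mul_left_cancel₀ hne (by linarith)
      have hj : u.imJ = 0 := mul_left_cancel₀ hne (by linarith)
      have hk : u.imK = 0 := mul_left_cancel₀ hne (by linarith)
      rw [hi, hj, hk] at h0
      nlinarith [sq_nonneg u.re]
    rw [hre] at h0 ⊢
    exact ⟨rfl, by linarith⟩
  · rintro ⟨hre, hn⟩
    rw [hre] at hn ⊢
    refine ⟨by linarith, by ring, by ring, by ring⟩

/-- A nonzero solution of the system `s y = u x`, `s x = -u y`, with `s` real and nonzero, exists
iff `u * u = -s ^ 2`. -/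
lemma Quaternion.exists_ne_zero_coe_mul_eq_iff {s : ℝ} (hs : s ≠ 0) (u : ℍ[ℝ]) :
    (∃ v : Fin 2 → ℍ[ℝ], v ≠ 0 ∧ (s : ℍ[ℝ]) * v 1 = u * v 0 ∧ (s : ℍ[ℝ]) * v 0 = -(u * v 1)) ↔
      u * u = -((s : ℍ[ℝ]) * (s : ℍ[ℝ])) := by
  have hs' : (s : ℍ[ℝ]) ≠ 0 := fun h => hs (by simpa using congrArg (fun x : ℍ[ℝ] => x.re) h)
  constructor
  · rintro ⟨v, hv, h1, h0⟩
    have hx : v 0 ≠ 0 := by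
      intro hx
      rw [hx, mul_zero] at h1
      have hy := (mul_eq_zero.mp h1).resolve_left hs'
      exact hv (by ext1 i; fin_cases i <;> simpa)
    refine mul_right_cancel₀ hx ?_
    rw [mul_assoc, ← h1, ← mul_assoc, ← Quaternion.coe_commutes, mul_assoc, neg_mul, mul_assoc, h0,
      mul_neg, neg_neg]
  · intro h
    refine ⟨![s, u], fun h0 => hs' (by simpa using congrFun h0 0), ?_, ?_⟩
    · simpa using Quaternion.coe_commutes s u
    · simp [h]

theorem left_eigenvalue_iff_norm_one_and_re_eq_cos
    (q : ℍ[ℝ]) (hq : ‖q‖ = 1) (θ : ℝ) (hθ : Real.sin θ ≠ 0)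
    (A : Matrix (Fin 2) (Fin 2) ℍ[ℝ])
    (hA : A = !![q * (Real.cos θ : ℍ[ℝ]), -(q * (Real.sin θ : ℍ[ℝ]));
                 q * (Real.sin θ : ℍ[ℝ]), q * (Real.cos θ : ℍ[ℝ])])
    (σ : ℍ[ℝ]) :
    (∃ v : Fin 2 → ℍ[ℝ], v ≠ 0 ∧ A.mulVec v = σ • v) ↔
    (‖σ‖ = 1 ∧ (star q * σ).re = Real.cos θ) := by
  have hq0 : q ≠ 0 := norm_ne_zero_iff.mp (by rw [hq]; exact one_ne_zero)
  have hqq : q * star q = 1 := by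
    rw [self_mul_star, normSq_eq_norm_mul_self, hq]; simp
  obtain ⟨w, hw⟩ : ∃ w, w = star q * σ := ⟨_, rfl⟩
  have hσ : σ = q * w := by rw [hw, ← mul_assoc, hqq, one_mul]
  have hnorm : ‖σ‖ = ‖w‖ := by rw [hσ, norm_mul, hq, one_mul]
  have heig (v : Fin 2 → ℍ[ℝ]) : A.mulVec v = σ • v ↔
      (Real.sin θ : ℍ[ℝ]) * v 1 = ((Real.cos θ : ℍ[ℝ]) - w) * v 0 ∧
        (Real.sin θ : ℍ[ℝ]) * v 0 = -(((Real.cos θ : ℍ[ℝ]) - w) * v 1) := by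
    have h0 : A.mulVec v 0 = q * ((Real.cos θ : ℍ[ℝ]) * v 0 - (Real.sin θ : ℍ[ℝ]) * v 1) := by
      simp only [hA, mulVec, dotProduct, Fin.sum_univ_two, of_apply, cons_val_zero, cons_val_one]
      noncomm_ring
    have h1 : A.mulVec v 1 = q * ((Real.sin θ : ℍ[ℝ]) * v 0 + (Real.cos θ : ℍ[ℝ]) * v 1) := by
      simp only [hA, mulVec, dotProduct, Fin.sum_univ_two, of_apply, cons_val_zero, cons_val_one]
      noncomm_ring
    rw [funext_iff, Fin.forall_fin_two, h0, h1, Pi.smul_apply, Pi.smul_apply, smul_eq_mul,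
      smul_eq_mul, hσ, mul_assoc, mul_assoc, mul_right_inj' hq0, mul_right_inj' hq0, sub_mul,
      sub_mul]
    refine and_congr ?_ ?_
    · rw [sub_eq_iff_eq_add, eq_sub_iff_add_eq, eq_comm, add_comm]
    · rw [neg_sub, eq_sub_iff_add_eq]
  simp only [heig]
  rw [Quaternion.exists_ne_zero_coe_mul_eq_iff hθ, Quaternion.mul_self_eq_neg_coe_sq_iff hθ,
    ← hw, hnorm, ← sq_eq_sq₀ (norm_nonneg w) zero_le_one, sq ‖w‖, ← normSq_eq_norm_mul_self]
  simp only [normSq_def', re_sub, imI_sub, imJ_sub, imK_sub, re_coe, imI_coe, imJ_coe, imK_coe]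
  have hcs := Real.sin_sq_add_cos_sq θ
  constructor
  · rintro ⟨hre, hn⟩
    have hre' : w.re = Real.cos θ := by linarith
    rw [hre'] at hn ⊢
    exact ⟨by linarith, rfl⟩
  · rintro ⟨hn, hre⟩
    rw [hre] at hn ⊢
    exact ⟨by ring, by linarith⟩
end

section
/- Let q be a quaternion with |q| = 1, let θ be a real number with sin θ ≠ 0, and let A = [[q·cos θ, −q·sin θ], [q·sin θ, q·cos θ]]. A quaternion σ is a left eigenvalue of A if and only if q̄·σ is conjugate (similar) to the quaternion cos θ + i·sin θ, i.e., there exists a nonzero quaternion p such that q̄·σ = p·(cos θ + i·sin θ)·p⁻¹. -/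
open Quaternion Matrix

/-- The imaginary unit `i` of the real quaternions. -/
def Quaternion.unitI : ℍ[ℝ] := ⟨0, 1, 0, 0⟩

/-- The imaginary unit `j` of the real quaternions. -/
def Quaternion.unitJ : ℍ[ℝ] := ⟨0, 0, 1, 0⟩

theorem Quaternion.unitI_mul_self : unitI * unitI = -1 := by
  apply Quaternion.ext <;> simp only [re_mul, imI_mul, imJ_mul, imK_mul, re_neg, imI_neg, imJ_neg,
    imK_neg, re_one, imI_one, imJ_one, imK_one] <;> norm_num [unitI]

theorem Quaternion.neg_unitI_mul_unitJ : -unitI * unitJ = unitJ * unitI := by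
  apply Quaternion.ext <;> simp only [re_mul, imI_mul, imJ_mul, imK_mul, re_neg, imI_neg, imJ_neg,
    imK_neg] <;> norm_num [unitI, unitJ]

theorem Quaternion.exists_mul_eq_mul_i_of_mul_self_eq_neg_one
    (w : ℍ[ℝ]) (hw : w * w = -1) :
    ∃ p : ℍ[ℝ], p ≠ 0 ∧ w * p = p * unitI := by
  by_cases h : 1 - w * unitI = 0
  · have hwi : w = -unitI := by
      have h1 : w * unitI * unitI = unitI := by rw [← sub_eq_zero.mp h, one_mul]
      rw [mul_assoc, unitI_mul_self, mul_neg_one] at h1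
      rw [← h1, neg_neg]
    refine ⟨unitJ, fun h0 => ?_, hwi ▸ neg_unitI_mul_unitJ⟩
    have h1 : unitJ.imJ = 0 := by rw [h0, imJ_zero]
    simp [unitJ] at h1
  · refine ⟨1 - w * unitI, h, ?_⟩
    rw [mul_sub, sub_mul, ← mul_assoc, hw, mul_assoc w unitI unitI, unitI_mul_self]
    simp [add_comm]

/-- A left eigenvector equation for a rotation matrix amounts to a square root of `-1`. -/
theorem Quaternion.exists_rotation_mulVec_iff {a b : ℝ} (hb : b ≠ 0) (τ : ℍ[ℝ]) :
    (∃ v : Fin 2 → ℍ[ℝ], v ≠ 0 ∧ a • v 0 - b • v 1 = τ * v 0 ∧ b • v 0 + a • v 1 = τ * v 1) ↔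
    ∃ w : ℍ[ℝ], w * w = -1 ∧ τ = (a : ℍ[ℝ]) + b • w := by
  constructor
  · rintro ⟨v, hv, h0, h1⟩
    obtain ⟨w, rfl⟩ : ∃ w : ℍ[ℝ], τ = (a : ℍ[ℝ]) + b • w :=
      ⟨b⁻¹ • (τ - (a : ℍ[ℝ])), by rw [smul_inv_smul₀ hb]; abel⟩
    rw [add_mul, coe_mul_eq_smul, smul_mul_assoc] at h0 h1
    have e0 : -v 1 = w * v 0 := by
      apply smul_right_injective _ hb
      simp only [smul_neg]
      rw [sub_eq_add_neg] at h0
      exact add_left_cancel h0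
    have e1 : v 0 = w * v 1 := by
      apply smul_right_injective _ hb
      rw [add_comm] at h1
      exact add_left_cancel h1
    have hv1 : v 1 ≠ 0 := fun h => hv (by
      funext k
      fin_cases k
      · simpa [h] using e1
      · simpa using h)
    refine ⟨w, mul_right_cancel₀ hv1 ?_, rfl⟩
    rw [mul_assoc, ← e1, ← e0, neg_one_mul]
  · rintro ⟨w, hw, rfl⟩
    refine ⟨![w, 1], fun h => by simpa using congrFun h 1, ?_, ?_⟩
    · simp [add_mul, hw, coe_mul_eq_smul, sub_eq_add_neg]
    · simp [add_comm, ← mul_coe_eq_smul]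

theorem left_eigenvalue_iff_conjugate_to_cos_add_i_sin
    (q : ℍ[ℝ]) (hq : ‖q‖ = 1) (θ : ℝ) (hθ : Real.sin θ ≠ 0)
    (A : Matrix (Fin 2) (Fin 2) ℍ[ℝ])
    (hA : A = !![q * (Real.cos θ : ℍ[ℝ]), -(q * (Real.sin θ : ℍ[ℝ]));
                 q * (Real.sin θ : ℍ[ℝ]), q * (Real.cos θ : ℍ[ℝ])])
    (c : ℍ[ℝ]) (hc : c = ⟨Real.cos θ, Real.sin θ, 0, 0⟩)
    (σ : ℍ[ℝ]) :
    (∃ v : Fin 2 → ℍ[ℝ], v ≠ 0 ∧ A.mulVec v = σ • v) ↔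
    ∃ p : ℍ[ℝ], p ≠ 0 ∧ star q * σ = p * c * p⁻¹ := by
  have hc' : c = (Real.cos θ : ℍ[ℝ]) + Real.sin θ • unitI := by
    rw [hc]
    apply Quaternion.ext <;> simp only [re_add, imI_add, imJ_add, imK_add, re_smul, imI_smul,
      imJ_smul, imK_smul, re_coe, imI_coe, imJ_coe, imK_coe] <;> simp [unitI]
  have hqq : star q * q = 1 := by
    rw [star_mul_self, normSq_eq_norm_mul_self, hq]
    simp
  have hq0 : star q ≠ 0 := left_ne_zero_of_mul_eq_one hqq
  have key (x y : ℍ[ℝ]) : q * x = σ * y ↔ x = star q * σ * y := by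
    rw [← mul_right_inj' hq0, ← mul_assoc, hqq, one_mul, mul_assoc]
  have hv (v : Fin 2 → ℍ[ℝ]) : A.mulVec v = σ • v ↔
      Real.cos θ • v 0 - Real.sin θ • v 1 = star q * σ * v 0 ∧
      Real.sin θ • v 0 + Real.cos θ • v 1 = star q * σ * v 1 := by
    rw [← key, ← key, funext_iff, Fin.forall_fin_two, hA]
    simp only [mulVec, dotProduct, Fin.sum_univ_two, Matrix.of_apply, Matrix.cons_val_zero,
      Matrix.cons_val_one, Pi.smul_apply, smul_eq_mul, neg_mul, mul_assoc, coe_mul_eq_smul,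
      mul_add, mul_sub, ← sub_eq_add_neg]
  simp only [hv]
  rw [Quaternion.exists_rotation_mulVec_iff hθ]
  have conj (p : ℍ[ℝ]) (hp : p ≠ 0) : p * c * p⁻¹ =
      (Real.cos θ : ℍ[ℝ]) + Real.sin θ • (p * unitI * p⁻¹) := by
    rw [hc', mul_add, add_mul, ← coe_commutes, mul_assoc _ p, mul_inv_cancel₀ hp, mul_one,
      mul_smul_comm, smul_mul_assoc]
  constructor
  · rintro ⟨w, hw, h⟩
    obtain ⟨p, hp, hwp⟩ := Quaternion.exists_mul_eq_mul_i_of_mul_self_eq_neg_one w hw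
    exact ⟨p, hp, by rw [h, conj p hp, ← hwp, mul_inv_cancel_right₀ hp]⟩
  · rintro ⟨p, hp, h⟩
    refine ⟨p * unitI * p⁻¹, ?_, h.trans (conj p hp)⟩
    rw [mul_assoc p, mul_assoc p, mul_assoc unitI, inv_mul_cancel_left₀ hp, ← mul_assoc unitI,
      unitI_mul_self, neg_one_mul, mul_neg, mul_inv_cancel₀ hp]
end

section
/- Given any four quaternions σ₁, σ₂, σ₃, σ₄ of norm 1, there exists a 2×2 symplectic quaternionic matrix A such that each σₘ (m = 1, …, 4) is a left eigenvalue of A. -/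
open Quaternion Matrix

/-- Four points of `ℍ` lie on a common affine hyperplane, which has a unit normal vector `q`. -/
lemma exists_unit_quaternion_re_star_mul_eq (σ : Fin 4 → ℍ[ℝ]) :
    ∃ q : ℍ[ℝ], star q * q = 1 ∧ ∀ m, (star q * σ m).re = (star q * σ 0).re := by
  let L : ℍ[ℝ] →ₗ[ℝ] (Fin 3 → ℝ) := LinearMap.pi fun i => innerₗ ℍ[ℝ] (σ i.succ - σ 0)
  have hL : LinearMap.ker L ≠ ⊥ := by
    apply LinearMap.ker_ne_bot_of_finrank_lt
    rw [Quaternion.finrank_eq_four, Module.finrank_fin_fun]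
    norm_num
  obtain ⟨p, hp, hp0⟩ := Submodule.exists_mem_ne_zero_of_ne_bot hL
  have hp' : ∀ i : Fin 3, inner ℝ (σ i.succ - σ 0) p = 0 := fun i => congrFun hp i
  refine ⟨(‖p‖⁻¹ : ℝ) • p, ?_, ?_⟩
  · have hn : ‖(‖p‖⁻¹ : ℝ) • p‖ = 1 := norm_smul_inv_norm (𝕜 := ℝ) hp0
    rw [Quaternion.star_mul_self, Quaternion.normSq_eq_norm_mul_self, hn]
    simp
  · intro m
    refine Fin.cases rfl (fun i => ?_) m
    have h := hp' i
    rw [Quaternion.inner_def] at h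
    simp only [Quaternion.re_mul, Quaternion.re_star, Quaternion.imI_star, Quaternion.imJ_star,
      Quaternion.imK_star, Quaternion.re_sub, Quaternion.imI_sub, Quaternion.imJ_sub,
      Quaternion.imK_sub, Quaternion.re_smul, Quaternion.imI_smul, Quaternion.imJ_smul,
      Quaternion.imK_smul, smul_eq_mul] at h ⊢
    linear_combination ‖p‖⁻¹ * h

/-- A unit quaternion is a root of its characteristic polynomial. -/
lemma Quaternion.mul_self_eq_of_norm_eq_one {τ : ℍ[ℝ]} (hτ : ‖τ‖ = 1) :
    τ * τ = (2 * τ.re) • τ - 1 := by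
  have h1 : τ * star τ = 1 := by
    rw [Quaternion.self_mul_star, Quaternion.normSq_eq_norm_mul_self, hτ]
    simp
  have h2 : τ = ((2 * τ.re : ℝ) : ℍ[ℝ]) - star τ := by
    rw [Quaternion.coe_mul]
    exact eq_sub_of_add_eq (Quaternion.self_add_star τ)
  calc τ * τ = τ * (((2 * τ.re : ℝ) : ℍ[ℝ]) - star τ) := by rw [← h2]
    _ = (2 * τ.re) • τ - 1 := by rw [mul_sub, h1, Quaternion.mul_coe_eq_smul]

/-- The product of a unit quaternion `q` and the plane rotation `(c, s)` is symplectic. -/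
lemma smul_rotation_mul_conjTranspose {q : ℍ[ℝ]} (hq : q * star q = 1) {c s : ℝ}
    (hcs : c ^ 2 + s ^ 2 = 1) :
    !![c • q, -(s • q); s • q, c • q] * !![c • q, -(s • q); s • q, c • q]ᴴ = 1 := by
  have h : (c * c) • (1 : ℍ[ℝ]) + (s * s) • (1 : ℍ[ℝ]) = 1 := by
    rw [← add_smul, ← sq, ← sq, hcs, one_smul]
  ext1 i j
  fin_cases i <;> fin_cases j <;>
    simp [Matrix.mul_apply, Fin.sum_univ_two, hq, smul_smul, mul_comm s c]
  · exact h
  · rw [add_comm]; exact h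

/-- The left eigenvalues of `q` times the rotation `(c, s)` include every unit quaternion `σ` with
`⟪q, σ⟫ = c`. -/
lemma exists_left_eigenvector_smul_rotation {q σ : ℍ[ℝ]} (hq : q * star q = 1) {c s : ℝ}
    (hcs : c ^ 2 + s ^ 2 = 1) (hτ : ‖star q * σ‖ = 1) (hc : (star q * σ).re = c) :
    ∃ v : Fin 2 → ℍ[ℝ], v ≠ 0 ∧
      !![c • q, -(s • q); s • q, c • q].mulVec v = σ • v := by
  obtain ⟨τ, rfl⟩ : ∃ τ, σ = q * τ := ⟨star q * σ, by rw [← mul_assoc, hq, one_mul]⟩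
  have hq' : star q * q = 1 := mul_eq_one_comm.mp hq
  rw [← mul_assoc, hq', one_mul] at hτ hc
  have hsq := Quaternion.mul_self_eq_of_norm_eq_one hτ
  rw [hc] at hsq
  by_cases hs : s = 0
  · subst hs
    have hc2 : c * c = 1 := by linarith
    have hτc : τ = (c : ℍ[ℝ]) := by
      have h0 : (τ - (c : ℍ[ℝ])) * (τ - (c : ℍ[ℝ])) = 0 := by
        rw [sub_mul, mul_sub, mul_sub, hsq, Quaternion.mul_coe_eq_smul,
          Quaternion.coe_mul_eq_smul, ← Quaternion.coe_mul, hc2, Quaternion.coe_one]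
        module
      exact sub_eq_zero.mp (mul_self_eq_zero.mp h0)
    refine ⟨![1, 0], fun h => one_ne_zero (congrFun h 0), ?_⟩
    ext1 i
    fin_cases i <;> simp [Matrix.mulVec, dotProduct, Fin.sum_univ_two, hτc,
      Quaternion.mul_coe_eq_smul]
  · refine ⟨![(s : ℍ[ℝ]), (c : ℍ[ℝ]) - τ], fun h => hs ?_, ?_⟩
    · exact Quaternion.coe_injective ((congrFun h 0).trans Quaternion.coe_zero.symm)
    · ext1 i
      fin_cases i
      · simp [Matrix.mulVec, dotProduct, Fin.sum_univ_two, Quaternion.mul_coe_eq_smul, mul_sub]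
        module
      · have hone : (s * s) • q = q - (c * c) • q := by
          rw [show s * s = 1 - c * c by linarith, sub_smul, one_smul]
        simp [Matrix.mulVec, dotProduct, Fin.sum_univ_two, Quaternion.mul_coe_eq_smul, mul_sub,
          mul_assoc, hsq, smul_smul, hone]
        module

theorem exists_symplectic_with_four_prescribed_left_eigenvalues
    (σ : Fin 4 → ℍ[ℝ]) (hσ : ∀ m, ‖σ m‖ = 1) :
    ∃ A : Matrix (Fin 2) (Fin 2) ℍ[ℝ], A * Aᴴ = 1 ∧
      ∀ m, ∃ v : Fin 2 → ℍ[ℝ], v ≠ 0 ∧ A.mulVec v = (σ m) • v := by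
  obtain ⟨q, hq', hre⟩ := exists_unit_quaternion_re_star_mul_eq σ
  have hq : q * star q = 1 := mul_eq_one_comm.mp hq'
  have hqn : ‖star q‖ = 1 := by
    have h := congrArg norm hq'
    rw [norm_mul, norm_star, norm_one] at h
    rw [norm_star]
    nlinarith [norm_nonneg q]
  have hτ : ∀ m, ‖star q * σ m‖ = 1 := fun m => by rw [norm_mul, hqn, hσ, one_mul]
  set c := (star q * σ 0).re
  have hc1 : c ^ 2 ≤ 1 := by
    have h := Quaternion.normSq_eq_norm_mul_self (star q * σ 0)
    rw [hτ, Quaternion.normSq_def'] at h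
    nlinarith [sq_nonneg (star q * σ 0).imI, sq_nonneg (star q * σ 0).imJ,
      sq_nonneg (star q * σ 0).imK]
  have hcs : c ^ 2 + √(1 - c ^ 2) ^ 2 = 1 := by
    rw [Real.sq_sqrt (by linarith)]
    ring
  exact ⟨_, smul_rotation_mul_conjTranspose hq hcs, fun m =>
    exists_left_eigenvector_smul_rotation hq hcs (hτ m) (hre m)⟩
end

section
/- For any four quaternions σ₁, σ₂, σ₃, σ₄ of norm 1, the four open sets Ω(σ₁), Ω(σ₂), Ω(σ₃), Ω(σ₄) do not cover Sp(2); that is, there exists a 2×2 symplectic quaternionic matrix A such that A − σₘ·I is not invertible for every m = 1, …, 4. -/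
open Quaternion Matrix

/-- Four quaternions always lie on a common affine real hyperplane. -/
theorem exists_unit_inner_eq_const (σ : Fin 4 → ℍ[ℝ]) :
    ∃ q : ℍ[ℝ], ‖q‖ = 1 ∧ ∀ m, (star q * σ m).re = (star q * σ 0).re := by
  let f : ℍ[ℝ] →ₗ[ℝ] (Fin 3 → ℝ) := LinearMap.pi fun i => innerₗ ℍ[ℝ] (σ i.succ - σ 0)
  have hf : LinearMap.ker f ≠ ⊥ := LinearMap.ker_ne_bot_of_finrank_lt (by
    rw [Quaternion.finrank_eq_four, Module.finrank_fin_fun]; norm_num)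
  obtain ⟨p, hp, hp0⟩ := (Submodule.ne_bot_iff _).1 hf
  refine ⟨(‖p‖⁻¹ : ℝ) • p, norm_smul_inv_norm (𝕜 := ℝ) hp0, fun m => ?_⟩
  refine Fin.cases rfl (fun i => ?_) m
  have h : inner ℝ (σ i.succ - σ 0) p = 0 := congrFun (LinearMap.mem_ker.1 hp) i
  simp only [Quaternion.inner_def, Quaternion.re_mul, Quaternion.re_sub, Quaternion.imI_sub,
    Quaternion.imJ_sub, Quaternion.imK_sub, Quaternion.re_star, Quaternion.imI_star,
    Quaternion.imJ_star, Quaternion.imK_star] at h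
  simp only [Quaternion.re_mul, Quaternion.re_star, Quaternion.imI_star, Quaternion.imJ_star,
    Quaternion.imK_star, Quaternion.re_smul, Quaternion.imI_smul, Quaternion.imJ_smul,
    Quaternion.imK_smul, smul_eq_mul]
  linear_combination ‖p‖⁻¹ * h

theorem Quaternion.normSq_eq_one_of_norm_eq_one {w : ℍ[ℝ]} (hw : ‖w‖ = 1) : normSq w = 1 := by
  rw [Quaternion.normSq_eq_norm_mul_self, hw, one_mul]

/-- The imaginary part of a unit quaternion squares to `re ^ 2 - 1`. -/
theorem Quaternion.im_mul_im_of_norm_eq_one {w : ℍ[ℝ]} (hw : ‖w‖ = 1) :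
    w.im * w.im = ((w.re ^ 2 - 1 : ℝ) : ℍ[ℝ]) := by
  have h := normSq_eq_one_of_norm_eq_one hw
  rw [Quaternion.normSq_def'] at h
  ext <;> simp [-Quaternion.coe_sub, -Quaternion.coe_pow] <;> linarith

/-- The rotation matrix with cosine `c` and sine `s`, multiplied on the left by `q`. -/
noncomputable def quaternionicRotation (q : ℍ[ℝ]) (c s : ℝ) : Matrix (Fin 2) (Fin 2) ℍ[ℝ] :=
  !![q * c, -(q * s); q * s, q * c]

theorem quaternionicRotation_mul_conjTranspose {q : ℍ[ℝ]} (hq : ‖q‖ = 1) {c s : ℝ}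
    (hcs : c ^ 2 + s ^ 2 = 1) :
    quaternionicRotation q c s * (quaternionicRotation q c s)ᴴ = 1 := by
  have h := normSq_eq_one_of_norm_eq_one hq
  rw [Quaternion.normSq_def'] at h
  ext i j <;> fin_cases i <;> fin_cases j <;>
    simp [quaternionicRotation, Matrix.mul_apply, Fin.sum_univ_two] <;>
    first
    | ring1
    | linear_combination (c ^ 2 + s ^ 2) * h + hcs

/-- Every unit quaternion `σ` with `Re (q̄ σ) = c` is a left eigenvalue of
`quaternionicRotation q c s`. -/
theorem not_isUnit_quaternionicRotation_sub {q σ : ℍ[ℝ]} (hq : ‖q‖ = 1) (hσ : ‖σ‖ = 1) {c s : ℝ}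
    (hcs : c ^ 2 + s ^ 2 = 1) (hc : (star q * σ).re = c) :
    ¬ IsUnit (quaternionicRotation q c s - σ • (1 : Matrix (Fin 2) (Fin 2) ℍ[ℝ])) := by
  set u := (star q * σ).im with hu
  have hqq : q * star q = 1 := by
    rw [Quaternion.self_mul_star, normSq_eq_one_of_norm_eq_one hq, Quaternion.coe_one]
  have hσu : σ = q * (c + u) := by
    rw [← hc, hu, Quaternion.re_add_im, ← mul_assoc, hqq, one_mul]
  have huu : u * u = -((s : ℍ[ℝ]) * s) := by
    rw [hu, Quaternion.im_mul_im_of_norm_eq_one (by rw [norm_mul, norm_star, hq, hσ, one_mul]), hc,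
      ← Quaternion.coe_mul, ← Quaternion.coe_neg]
    congr 1
    linarith
  have hsu : (s : ℍ[ℝ]) * u = u * s := Quaternion.coe_commutes s u
  have hA : quaternionicRotation q c s - σ • (1 : Matrix (Fin 2) (Fin 2) ℍ[ℝ]) =
      q • !![-u, -(s : ℍ[ℝ]); (s : ℍ[ℝ]), -u] := by
    ext1 i j
    fin_cases i <;> fin_cases j <;> simp [quaternionicRotation, hσu, mul_add]
  have hmul : !![-u, -(s : ℍ[ℝ]); (s : ℍ[ℝ]), -u] * !![-u, (s : ℍ[ℝ]); -(s : ℍ[ℝ]), -u] = 0 := by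
    ext1 i j
    fin_cases i <;> fin_cases j <;> simp [Matrix.mul_apply, Fin.sum_univ_two, huu, hsu]
  rw [hA]
  intro hunit
  have hM := hunit.mul_right_eq_zero.1 (by rw [smul_mul_assoc, hmul, smul_zero])
  have hu0 : u = 0 := by simpa using congrFun₂ hM 0 0
  have hs0 : (s : ℍ[ℝ]) = 0 := congrFun₂ hM 0 1
  refine hunit.ne_zero ?_
  ext1 i j
  fin_cases i <;> fin_cases j <;> simp [hu0, hs0]

theorem four_omega_sets_do_not_cover_Sp2
    (σ : Fin 4 → ℍ[ℝ]) (hσ : ∀ m, ‖σ m‖ = 1) :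
    ∃ A : Matrix (Fin 2) (Fin 2) ℍ[ℝ], A * Aᴴ = 1 ∧
      ∀ m, ¬ IsUnit (A - (σ m) • (1 : Matrix (Fin 2) (Fin 2) ℍ[ℝ])) := by
  obtain ⟨q, hq, hc⟩ := exists_unit_inner_eq_const σ
  set c := (star q * σ 0).re
  have hc1 : c ^ 2 ≤ 1 := by
    have h : normSq (star q * σ 0) = 1 :=
      normSq_eq_one_of_norm_eq_one (by rw [norm_mul, norm_star, hq, hσ, one_mul])
    rw [Quaternion.normSq_def'] at h
    nlinarith [sq_nonneg (star q * σ 0).imI, sq_nonneg (star q * σ 0).imJ,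
      sq_nonneg (star q * σ 0).imK]
  have hcs : c ^ 2 + √(1 - c ^ 2) ^ 2 = 1 := by
    rw [Real.sq_sqrt (sub_nonneg.2 hc1)]
    ring
  exact ⟨quaternionicRotation q c √(1 - c ^ 2), quaternionicRotation_mul_conjTranspose hq hcs,
    fun m => not_isUnit_quaternionicRotation_sub hq (hσ m) hcs (hc m)⟩
end

section
/- Let u = 1 + i + j + k. The matrix A = (1/4)·[[u, −√3·u], [√3·u, u]] is a 2×2 symplectic quaternionic matrix and each of the quaternions 1, i, j, k is a left eigenvalue of A. -/
open Quaternion Matrix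

theorem example_matrix_is_symplectic_with_eigenvalues_one_i_j_k
    (u : ℍ[ℝ]) (hu : u = ⟨1, 1, 1, 1⟩)
    (A : Matrix (Fin 2) (Fin 2) ℍ[ℝ])
    (hA : A = ((1 / 4 : ℝ) : ℍ[ℝ]) •
      !![u, -(((Real.sqrt 3 : ℝ) : ℍ[ℝ]) * u);
         ((Real.sqrt 3 : ℝ) : ℍ[ℝ]) * u, u]) :
    A * Aᴴ = 1 ∧
    ∀ σ ∈ ({1, ⟨0, 1, 0, 0⟩, ⟨0, 0, 1, 0⟩, ⟨0, 0, 0, 1⟩} : Set ℍ[ℝ]),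
      ∃ v : Fin 2 → ℍ[ℝ], v ≠ 0 ∧ A.mulVec v = σ • v := by
  have h3 : Real.sqrt 3 * Real.sqrt 3 = 3 := Real.mul_self_sqrt (by norm_num)
  have h3_ne : Real.sqrt 3 ≠ 0 := by positivity
  obtain ⟨hre, hi, hj, hk⟩ : u.re = 1 ∧ u.imI = 1 ∧ u.imJ = 1 ∧ u.imK = 1 := by simp [hu]
  clear hu
  generalize hc : (1 / 4 : ℝ) = c at hA
  generalize Real.sqrt 3 = s at *
  subst hA
  constructor
  · ext a b <;> fin_cases a <;> fin_cases b <;>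
      simp [Matrix.mul_apply, Fin.sum_univ_two, hre, hi, hj, hk] <;> grind
  · intro σ hσ
    refine ⟨![(s : ℍ[ℝ]), 1 - star u * σ], ?_, ?_⟩
    · intro h
      apply h3_ne
      simpa using congrArg (fun w : Fin 2 → ℍ[ℝ] => (w 0).re) h
    · have hcases : (σ.re = 1 ∧ σ.imI = 0 ∧ σ.imJ = 0 ∧ σ.imK = 0) ∨
          (σ.re = 0 ∧ σ.imI = 1 ∧ σ.imJ = 0 ∧ σ.imK = 0) ∨
          (σ.re = 0 ∧ σ.imI = 0 ∧ σ.imJ = 1 ∧ σ.imK = 0) ∨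
          (σ.re = 0 ∧ σ.imI = 0 ∧ σ.imJ = 0 ∧ σ.imK = 1) := by
        simp only [Set.mem_insert_iff] at hσ
        rcases hσ with rfl | rfl | rfl | rfl <;> simp
      clear hσ
      rcases hcases with ⟨h₀, h₁, h₂, h₃⟩ | ⟨h₀, h₁, h₂, h₃⟩ | ⟨h₀, h₁, h₂, h₃⟩ | ⟨h₀, h₁, h₂, h₃⟩ <;>
        · ext a <;> fin_cases a <;>
            simp [Matrix.mulVec, dotProduct, Fin.sum_univ_two, hre, hi, hj, hk,
              h₀, h₁, h₂, h₃] <;> grind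
end

section
/- Let u = 1 + i + j + k. If A is a 2×2 symplectic quaternionic matrix such that each of the quaternions 1, i, j, k is a left eigenvalue of A, then A = (1/4)·[[u, −√3·u], [√3·u, u]] or A = (1/4)·[[u, √3·u], [−√3·u, u]]. -/
open Quaternion Matrix

/-- The quaternion with the given real components. -/
def quat (a b c d : ℝ) : ℍ[ℝ] := ⟨a, b, c, d⟩

section
variable (a b c d : ℝ)

@[simp] lemma re_quat : (quat a b c d).re = a := rfl
@[simp] lemma imI_quat : (quat a b c d).imI = b := rfl
@[simp] lemma imJ_quat : (quat a b c d).imJ = c := rfl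
@[simp] lemma imK_quat : (quat a b c d).imK = d := rfl

end

/-- If `b ≠ 0`, the left eigenvalues of `!![a, b; c, d]` satisfy a quadratic equation. -/
lemma leftEigenvalue_quadratic {a b c d σ : ℍ[ℝ]} (hb : b ≠ 0) {x y : ℍ[ℝ]}
    (hxy : ¬ (x = 0 ∧ y = 0)) (h₁ : a * x + b * y = σ * x) (h₂ : c * x + d * y = σ * y) :
    σ * b⁻¹ * σ - d * b⁻¹ * σ - σ * (b⁻¹ * a) + (d * b⁻¹ * a - c) = 0 := by
  have hy : y = b⁻¹ * ((σ - a) * x) := by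
    rw [eq_inv_mul_iff_mul_eq₀ hb, sub_mul, ← h₁]
    abel
  have hx : x ≠ 0 := by
    rintro rfl
    exact hxy ⟨rfl, by simpa using hy⟩
  have h : (σ * b⁻¹ * σ - d * b⁻¹ * σ - σ * (b⁻¹ * a) + (d * b⁻¹ * a - c)) * x = 0 := by
    calc _ = σ * (b⁻¹ * ((σ - a) * x)) - (c * x + d * (b⁻¹ * ((σ - a) * x))) := by noncomm_ring
      _ = 0 := by rw [← hy, h₂, sub_self]
  exact (mul_eq_zero.mp h).resolve_right hx

/-- The quaternions `p, m, n, r` for which `1, i, j, k` are all roots of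
`σ * p * σ - m * σ - σ * n + r`. -/
lemma coeffs_of_quadratic_roots_one_i_j_k {p m n r : ℍ[ℝ]}
    (h : ∀ σ ∈ ({1, quat 0 1 0 0, quat 0 0 1 0, quat 0 0 0 1} : Set ℍ[ℝ]),
      σ * p * σ - m * σ - σ * n + r = 0) :
    p = quat p.re (-p.re) (-p.re) (-p.re) ∧ m = (m.re : ℍ[ℝ]) ∧ n = (n.re : ℍ[ℝ]) ∧
      m.re + n.re = 2 * p.re ∧ r = quat p.re p.re p.re p.re := by
  have h0 := h 1 (by simp)
  have h1 := h (quat 0 1 0 0) (by simp)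
  have h2 := h (quat 0 0 1 0) (by simp)
  have h3 := h (quat 0 0 0 1) (by simp)
  simp [Quaternion.ext_iff] at h0 h1 h2 h3
  obtain ⟨a0, a1, a2, a3⟩ := h0
  obtain ⟨b0, b1, b2, b3⟩ := h1
  obtain ⟨c0, c1, c2, c3⟩ := h2
  obtain ⟨d0, d1, d2, d3⟩ := h3
  simp only [Quaternion.ext_iff, Quaternion.re_coe, Quaternion.imI_coe, Quaternion.imJ_coe,
    Quaternion.imK_coe, re_quat, imI_quat, imJ_quat, imK_quat, true_and]
  refine ⟨⟨?_, ?_, ?_⟩, ⟨?_, ?_, ?_⟩, ⟨?_, ?_, ?_⟩, ?_, ?_, ?_, ?_, ?_⟩ <;> linarith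

lemma normSq_rows_of_mul_conjTranspose_eq_one {a b c d : ℍ[ℝ]}
    (h : !![a, b; c, d] * !![a, b; c, d]ᴴ = 1) :
    normSq a + normSq b = 1 ∧ normSq c + normSq d = 1 ∧
      normSq a * normSq c = normSq b * normSq d := by
  have h00 := congrFun (congrFun h 0) 0
  have h01 := congrFun (congrFun h 0) 1
  have h11 := congrFun (congrFun h 1) 1
  simp [Matrix.mul_apply, Fin.sum_univ_two, Quaternion.self_mul_star] at h00 h01 h11
  refine ⟨Quaternion.coe_injective (by simpa using h00),
    Quaternion.coe_injective (by simpa using h11), ?_⟩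
  have := congrArg normSq (eq_neg_of_add_eq_zero_left h01)
  simpa using this

lemma upper_right_ne_zero_of_leftEigenvalues {a b c d : ℍ[ℝ]}
    (h : !![a, b; c, d] * !![a, b; c, d]ᴴ = 1)
    (heig : ∀ σ ∈ ({1, quat 0 1 0 0, quat 0 0 1 0, quat 0 0 0 1} : Set ℍ[ℝ]),
      ∃ x y : ℍ[ℝ], ¬ (x = 0 ∧ y = 0) ∧ a * x + b * y = σ * x ∧ c * x + d * y = σ * y) :
    b ≠ 0 := by
  rintro rfl
  obtain ⟨ha, -, hac⟩ := normSq_rows_of_mul_conjTranspose_eq_one h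
  have ha' : normSq a = 1 := by simpa using ha
  have hc : c = 0 := by simpa [ha'] using hac
  subst hc
  have key : ∀ σ ∈ ({1, quat 0 1 0 0, quat 0 0 1 0, quat 0 0 0 1} : Set ℍ[ℝ]),
      a = σ ∨ d = σ := by
    intro σ hσ
    obtain ⟨x, y, hxy, h₁, h₂⟩ := heig σ hσ
    simp only [zero_mul, add_zero, zero_add, mul_eq_mul_right_iff] at h₁ h₂
    tauto
  have h0 := key 1 (by simp)
  have h1 := key (quat 0 1 0 0) (by simp)
  have h2 := key (quat 0 0 1 0) (by simp)
  rcases h0 with rfl | rfl <;> rcases h1 with h1 | h1 <;> rcases h2 with h2 | h2 <;>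
    simp_all [Quaternion.ext_iff]

lemma entries_of_symplectic_of_leftEigenvalues {a b c d : ℍ[ℝ]}
    (h : !![a, b; c, d] * !![a, b; c, d]ᴴ = 1)
    (heig : ∀ σ ∈ ({1, quat 0 1 0 0, quat 0 0 1 0, quat 0 0 0 1} : Set ℍ[ℝ]),
      ∃ x y : ℍ[ℝ], ¬ (x = 0 ∧ y = 0) ∧ a * x + b * y = σ * x ∧ c * x + d * y = σ * y) :
    ∃ t : ℝ, t ^ 2 = 3 ∧ a = (1 / 4 : ℝ) • quat 1 1 1 1 ∧ b = (1 / 4 * t) • quat 1 1 1 1 ∧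
      c = (-(1 / 4 * t)) • quat 1 1 1 1 ∧ d = (1 / 4 : ℝ) • quat 1 1 1 1 := by
  have hb := upper_right_ne_zero_of_leftEigenvalues h heig
  obtain ⟨hab, hcd, hac⟩ := normSq_rows_of_mul_conjTranspose_eq_one h
  obtain ⟨hp, hm, hn, hmn, hr⟩ := coeffs_of_quadratic_roots_one_i_j_k
    (p := b⁻¹) (m := d * b⁻¹) (n := b⁻¹ * a) (r := d * b⁻¹ * a - c) (fun σ hσ ↦ by
      obtain ⟨x, y, hxy, h₁, h₂⟩ := heig σ hσ
      exact leftEigenvalue_quadratic hb hxy h₁ h₂)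
  generalize (d * b⁻¹).re = m at hm hmn
  generalize (b⁻¹ * a).re = n at hn hmn
  generalize (b⁻¹).re = s at hp hr hmn
  have hs : s ≠ 0 := by
    rintro rfl
    exact inv_ne_zero hb (hp.trans (by ext <;> simp))
  have hd : d = m * b := by rw [← hm, inv_mul_cancel_right₀ hb]
  have ha : a = b * n := by rw [← hn, mul_inv_cancel_left₀ hb]
  have had : normSq a = normSq d := by linear_combination normSq d * hab - normSq a * hcd + hac
  have hmn2 : m ^ 2 = n ^ 2 := by
    have hb' : normSq b ≠ 0 := by simpa using hb
    rw [ha, hd] at had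
    simp only [map_mul, Quaternion.normSq_coe] at had
    apply mul_left_cancel₀ hb'
    linarith
  have hms : m = s ∧ n = s := by
    rcases sq_eq_sq_iff_eq_or_eq_neg.mp hmn2 with rfl | rfl
    · constructor <;> linarith
    · exact absurd (by linarith) hs
  obtain ⟨rfl, rfl⟩ := hms
  have hbu : b = (1 / (4 * n)) • quat 1 1 1 1 := by
    refine inv_injective (hp.trans (eq_inv_of_mul_eq_one_left ?_))
    ext <;> simp <;> field_simp
    ring
  have hau : a = (1 / 4 : ℝ) • quat 1 1 1 1 := by
    rw [ha, hbu]
    ext <;> simp <;> field_simp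
  have hn3 : 3 * n ^ 2 = 1 := by
    rw [hau, hbu] at hab
    simp [Quaternion.normSq_def'] at hab
    field_simp at hab
    linarith
  refine ⟨1 / n, ?_, hau, ?_, ?_, ?_⟩
  · field_simp
    linarith
  · rw [hbu]
    congr 1
    field_simp
  · have hc : c = n * a - quat n n n n := by
      rw [← hr, hm, sub_sub_cancel]
    rw [hc, hau]
    ext <;> simp <;> field_simp <;> linarith
  · rw [hd, hbu]
    ext <;> simp <;> field_simp

theorem symplectic_with_eigenvalues_one_i_j_k_is_one_of_two
    (u : ℍ[ℝ]) (hu : u = ⟨1, 1, 1, 1⟩)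
    (A : Matrix (Fin 2) (Fin 2) ℍ[ℝ]) (hA : A * Aᴴ = 1)
    (heig : ∀ σ ∈ ({1, ⟨0, 1, 0, 0⟩, ⟨0, 0, 1, 0⟩, ⟨0, 0, 0, 1⟩} : Set ℍ[ℝ]),
      ∃ v : Fin 2 → ℍ[ℝ], v ≠ 0 ∧ A.mulVec v = σ • v) :
    A = ((1 / 4 : ℝ) : ℍ[ℝ]) •
        !![u, -(((Real.sqrt 3 : ℝ) : ℍ[ℝ]) * u);
           ((Real.sqrt 3 : ℝ) : ℍ[ℝ]) * u, u] ∨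
    A = ((1 / 4 : ℝ) : ℍ[ℝ]) •
        !![u, ((Real.sqrt 3 : ℝ) : ℍ[ℝ]) * u;
           -(((Real.sqrt 3 : ℝ) : ℍ[ℝ]) * u), u] := by
  obtain ⟨a, b, c, d, rfl⟩ : ∃ a b c d, A = !![a, b; c, d] := ⟨_, _, _, _, Matrix.eta_fin_two A⟩
  have hu' : u = quat 1 1 1 1 := hu
  obtain ⟨t, ht, rfl, rfl, rfl, rfl⟩ := entries_of_symplectic_of_leftEigenvalues hA (by
    intro σ hσ
    obtain ⟨v, hv, h⟩ := heig σ hσ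
    refine ⟨v 0, v 1, fun h0 ↦ hv ?_, ?_, ?_⟩
    · ext1 i
      fin_cases i
      exacts [h0.1, h0.2]
    · simpa [Matrix.mulVec, dotProduct, Fin.sum_univ_two] using congrFun h 0
    · simpa [Matrix.mulVec, dotProduct, Fin.sum_univ_two] using congrFun h 1)
  have hsq : t ^ 2 = Real.sqrt 3 ^ 2 := by rw [ht, Real.sq_sqrt (by norm_num)]
  subst hu'
  clear hA heig ht
  generalize (1 / 4 : ℝ) = q
  rcases sq_eq_sq_iff_eq_or_eq_neg.mp hsq with rfl | rfl
  · right
    ext i j <;> fin_cases i <;> fin_cases j <;> simp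
  · left
    ext i j <;> fin_cases i <;> fin_cases j <;> simp
end

section
/- The five open sets Ω(1), Ω(i), Ω(j), Ω(k), Ω((i+j)/√2) cover Sp(2); that is, for every 2×2 symplectic quaternionic matrix A there exists σ among the five quaternions 1, i, j, k, (i+j)/√2 such that A − σ·I is invertible (equivalently, no 2×2 symplectic matrix has all five of these quaternions as left eigenvalues). -/
open Quaternion Matrix

section DivisionRing

variable {K : Type*} [DivisionRing K]

theorem isUnit_fin_two_of_schur_ne_zero {a b c d : K} (hb : b ≠ 0) (hs : c - d * b⁻¹ * a ≠ 0) :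
    IsUnit !![a, b; c, d] := by
  obtain ⟨s, hs'⟩ : ∃ s, s = c - d * b⁻¹ * a := ⟨_, rfl⟩
  rw [← hs'] at hs
  obtain rfl : c = s + d * b⁻¹ * a := by rw [hs']; abel
  refine ⟨⟨!![a, b; s + d * b⁻¹ * a, d], !![-(s⁻¹ * d * b⁻¹), s⁻¹;
    b⁻¹ + b⁻¹ * a * s⁻¹ * d * b⁻¹, -(b⁻¹ * a * s⁻¹)], ?_, ?_⟩, rfl⟩
  · ext i j
    fin_cases i <;> fin_cases j <;>
      simp [mul_apply, Fin.sum_univ_two, mul_add, add_mul, mul_assoc, hb, hs]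
  · ext i j
    fin_cases i <;> fin_cases j <;>
      simp [mul_apply, Fin.sum_univ_two, mul_add, add_mul, mul_assoc, hb, hs]
    abel

theorem isUnit_fin_two_lowerTriangular {a c d : K} (ha : a ≠ 0) (hd : d ≠ 0) :
    IsUnit !![a, 0; c, d] := by
  refine ⟨⟨!![a, 0; c, d], !![a⁻¹, 0; -(d⁻¹ * c * a⁻¹), d⁻¹], ?_, ?_⟩, rfl⟩ <;>
  · ext i j
    fin_cases i <;> fin_cases j <;>
      simp [mul_apply, Fin.sum_univ_two, mul_assoc, ha, hd]

theorem sub_smul_one_fin_two (A : Matrix (Fin 2) (Fin 2) K) (s : K) :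
    A - s • (1 : Matrix (Fin 2) (Fin 2) K) = !![A 0 0 - s, A 0 1; A 1 0, A 1 1 - s] := by
  ext i j
  fin_cases i <;> fin_cases j <;> simp

end DivisionRing

namespace Quaternion

theorem re_mul_comm_s13 (p q : ℍ[ℝ]) : (p * q).re = (q * p).re := by
  simp only [re_mul]
  ring

/-- Distinct roots of a monic quaternionic quadratic have real parts summing to minus the real part
of the linear coefficient. -/
theorem re_add_re_of_quadratic {p q y z : ℍ[ℝ]} (hyz : y ≠ z)
    (hy : y * y + p * y + q = 0) (hz : z * z + p * z + q = 0) : y.re + z.re = -p.re := by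
  have hd : y - z ≠ 0 := sub_ne_zero.2 hyz
  have h : p * (y - z) = -(y * (y - z) + (y - z) * z) := by
    rw [← sub_eq_zero]
    calc _ = (y * y + p * y + q) - (z * z + p * z + q) := by noncomm_ring
      _ = 0 := by rw [hy, hz, sub_zero]
  have hp : p = -(y + (y - z) * z * (y - z)⁻¹) := by
    rw [(eq_mul_inv_iff_mul_eq₀ hd).2 h, neg_mul, add_mul, mul_inv_cancel_right₀ hd]
  have hr : ((y - z) * z * (y - z)⁻¹).re = z.re := by
    rw [re_mul_comm_s13, inv_mul_cancel_left₀ hd]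
  rw [hp, re_neg, re_add, hr, neg_neg]

/-- Left eigenvalues of a quaternionic `2 × 2` matrix with nonzero upper right entry `A 0 1`
correspond to roots of a quadratic. -/
theorem quadratic_of_not_isUnit {A : Matrix (Fin 2) (Fin 2) ℍ[ℝ]} (hb : A 0 1 ≠ 0) {s : ℍ[ℝ]}
    (hs : ¬ IsUnit (A - s • (1 : Matrix (Fin 2) (Fin 2) ℍ[ℝ]))) :
    ((A 0 1)⁻¹ * (s - A 0 0)) * ((A 0 1)⁻¹ * (s - A 0 0)) +
      ((A 0 1)⁻¹ * (A 0 0 - A 1 1)) * ((A 0 1)⁻¹ * (s - A 0 0)) + -((A 0 1)⁻¹ * A 1 0) = 0 := by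
  rw [sub_smul_one_fin_two] at hs
  have h : A 1 0 - (A 1 1 - s) * (A 0 1)⁻¹ * (A 0 0 - s) = 0 := by
    by_contra h
    exact hs (isUnit_fin_two_of_schur_ne_zero hb h)
  calc _ = -((A 0 1)⁻¹ * (A 1 0 - (A 1 1 - s) * (A 0 1)⁻¹ * (A 0 0 - s))) := by noncomm_ring
    _ = 0 := by rw [h, mul_zero, neg_zero]

theorem re_add_re_of_not_isUnit {A : Matrix (Fin 2) (Fin 2) ℍ[ℝ]} (hb : A 0 1 ≠ 0) {s t : ℍ[ℝ]}
    (hst : s ≠ t) (hs : ¬ IsUnit (A - s • (1 : Matrix (Fin 2) (Fin 2) ℍ[ℝ])))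
    (ht : ¬ IsUnit (A - t • (1 : Matrix (Fin 2) (Fin 2) ℍ[ℝ]))) :
    ((A 0 1)⁻¹ * (s - A 0 0)).re + ((A 0 1)⁻¹ * (t - A 0 0)).re =
      -((A 0 1)⁻¹ * (A 0 0 - A 1 1)).re := by
  refine re_add_re_of_quadratic (fun h => hst ?_) (quadratic_of_not_isUnit hb hs)
    (quadratic_of_not_isUnit hb ht)
  exact sub_left_injective (mul_left_cancel₀ (inv_ne_zero hb) h)

/-- The real part of `(A 0 1)⁻¹ * ·` agrees on left eigenvalues `s`, `t` of `A` that differ from a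
further left eigenvalue `u`. -/
theorem re_inv_mul_eq_of_not_isUnit {A : Matrix (Fin 2) (Fin 2) ℍ[ℝ]} (hb : A 0 1 ≠ 0)
    {s t u : ℍ[ℝ]} (hsu : s ≠ u) (htu : t ≠ u)
    (hs : ¬ IsUnit (A - s • (1 : Matrix (Fin 2) (Fin 2) ℍ[ℝ])))
    (ht : ¬ IsUnit (A - t • (1 : Matrix (Fin 2) (Fin 2) ℍ[ℝ])))
    (hu : ¬ IsUnit (A - u • (1 : Matrix (Fin 2) (Fin 2) ℍ[ℝ]))) :
    ((A 0 1)⁻¹ * s).re = ((A 0 1)⁻¹ * t).re := by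
  have h₁ := re_add_re_of_not_isUnit hb hsu hs hu
  have h₂ := re_add_re_of_not_isUnit hb htu ht hu
  simp only [mul_sub, re_sub] at h₁ h₂
  linarith

theorem eq_or_eq_of_not_isUnit {A : Matrix (Fin 2) (Fin 2) ℍ[ℝ]} (hb : A 0 1 = 0) {s : ℍ[ℝ]}
    (hs : ¬ IsUnit (A - s • (1 : Matrix (Fin 2) (Fin 2) ℍ[ℝ]))) : s = A 0 0 ∨ s = A 1 1 := by
  by_contra! h
  rw [sub_smul_one_fin_two, hb] at hs
  exact hs (isUnit_fin_two_lowerTriangular (sub_ne_zero.2 h.1.symm) (sub_ne_zero.2 h.2.symm))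

end Quaternion

theorem five_omega_sets_cover_Sp2
    (A : Matrix (Fin 2) (Fin 2) ℍ[ℝ]) (hA : A * Aᴴ = 1) :
    ∃ σ ∈ ({1, ⟨0, 1, 0, 0⟩, ⟨0, 0, 1, 0⟩, ⟨0, 0, 0, 1⟩,
            ⟨0, 1 / Real.sqrt 2, 1 / Real.sqrt 2, 0⟩} : Set ℍ[ℝ]),
      IsUnit (A - σ • (1 : Matrix (Fin 2) (Fin 2) ℍ[ℝ])) := by
  by_contra! h
  have h₁ := h _ (Or.inl rfl)
  have hi := h _ (Or.inr (Or.inl rfl))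
  have hj := h _ (Or.inr (Or.inr (Or.inl rfl)))
  have hk := h _ (Or.inr (Or.inr (Or.inr (Or.inl rfl))))
  have hl := h _ (Or.inr (Or.inr (Or.inr (Or.inr rfl))))
  have h1i : (1 : ℍ[ℝ]) ≠ ⟨0, 1, 0, 0⟩ := fun h => by simpa using congrArg (·.re) h
  have h1j : (1 : ℍ[ℝ]) ≠ ⟨0, 0, 1, 0⟩ := fun h => by simpa using congrArg (·.re) h
  have h1k : (1 : ℍ[ℝ]) ≠ ⟨0, 0, 0, 1⟩ := fun h => by simpa using congrArg (·.re) h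
  have h1l : (1 : ℍ[ℝ]) ≠ ⟨0, 1 / Real.sqrt 2, 1 / Real.sqrt 2, 0⟩ :=
    fun h => by simpa using congrArg (·.re) h
  have hij : (⟨0, 1, 0, 0⟩ : ℍ[ℝ]) ≠ ⟨0, 0, 1, 0⟩ := fun h => by simpa using congrArg (·.imI) h
  have hjk : (⟨0, 0, 1, 0⟩ : ℍ[ℝ]) ≠ ⟨0, 0, 0, 1⟩ := fun h => by simpa using congrArg (·.imJ) h
  by_cases hb : A 0 1 = 0
  · have e₁ := Quaternion.eq_or_eq_of_not_isUnit hb h₁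
    have ei := Quaternion.eq_or_eq_of_not_isUnit hb hi
    have ej := Quaternion.eq_or_eq_of_not_isUnit hb hj
    grind
  · have eij := Quaternion.re_inv_mul_eq_of_not_isUnit hb h1i.symm h1j.symm hi hj h₁
    have eik := Quaternion.re_inv_mul_eq_of_not_isUnit hb h1i.symm h1k.symm hi hk h₁
    have eil := Quaternion.re_inv_mul_eq_of_not_isUnit hb h1i.symm h1l.symm hi hl h₁
    have e1j := Quaternion.re_inv_mul_eq_of_not_isUnit hb h1k hjk h₁ hj hk
    apply inv_ne_zero hb
    generalize (A 0 1)⁻¹ = c at *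
    have hre (x y : ℍ[ℝ]) (hxy : (c * x).re = (c * y).re) :
        c.re * x.re - c.imI * x.imI - c.imJ * x.imJ - c.imK * x.imK =
          c.re * y.re - c.imI * y.imI - c.imJ * y.imJ - c.imK * y.imK := by
      simpa only [Quaternion.re_mul] using hxy
    replace eij := hre _ _ eij
    replace eik := hre _ _ eik
    replace eil := hre _ _ eil
    replace e1j := hre _ _ e1j
    clear * - eij eik eil e1j
    simp at eij eik eil e1j
    have hI : c.imI = 0 := by
      rw [← eij] at eil
      have hsq := Real.sq_sqrt (zero_le_two (α := ℝ))
      field_simp at eil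
      grind
    ext <;> simp <;> linarith
end

section
/- For every quaternion σ with |σ| = 1, the set Ω(σ) = {A ∈ Sp(2) : A − σ·I is invertible}, equipped with the subspace topology from the space of 2×2 quaternionic matrices, is a contractible topological space. -/
open Quaternion Matrix

theorem two_mul_inverse_two_mul_inv {R : Type*} [Ring R] (h2 : IsUnit (2 : R)) (u : Rˣ) :
    2 * Ring.inverse (2 * (↑u⁻¹ : R)) = u := by
  obtain ⟨t, ht⟩ := h2
  have hc : (t : R) * u = u * t := by rw [ht, two_mul, mul_two]
  rw [← ht, ← Units.val_mul, Ring.inverse_unit, _root_.mul_inv_rev, inv_inv, Units.val_mul, ← mul_assoc,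
    hc, mul_assoc, Units.mul_inv, mul_one]

/-- The Cayley transform: in a topological real star algebra with continuous inversion in which
`1 + S` is invertible for every skew-adjoint `S`, the elements `A` with `A * star A = 1` for which `A - w` is invertible, where `w`
is a fixed unitary, form a space homeomorphic to the space of skew-adjoint elements. -/
noncomputable def cayleyHomeomorph {R : Type*} [Ring R] [TopologicalSpace R] [IsTopologicalRing R]
    [StarRing R] [Algebra ℝ R] [StarModule ℝ R]
    (hinv : ∀ u : Rˣ, ContinuousAt Ring.inverse (u : R))
    (hR : ∀ S : R, star S = -S → IsUnit (1 + S))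
    {w : R} (hw : w * star w = 1) (hw' : star w * w = 1) :
    {A : R // A * star A = 1 ∧ IsUnit (A - w)} ≃ₜ skewAdjoint.submodule ℝ R :=
  have isUnit_w : IsUnit w := ⟨⟨w, star w, hw, hw'⟩, rfl⟩
  have h2 : IsUnit (2 : R) := by
    rw [← map_ofNat (algebraMap ℝ R) 2]
    exact (IsUnit.mk0 (2 : ℝ) two_ne_zero).map (algebraMap ℝ R)
  have isUnit_sub (A : R) (hA : IsUnit (A - w)) : IsUnit (1 - star w * A) := by
    have h : 1 - star w * A = -(star w * (A - w)) := by rw [mul_sub, hw']; abel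
    rw [h]
    exact (isUnit_w.star.mul hA).neg
  have isUnit_add (S : skewAdjoint.submodule ℝ R) : IsUnit (1 + (S : R)) :=
    hR S (skewAdjoint.mem_iff.1 S.2)
  { toFun := fun A => ⟨2 * Ring.inverse (1 - star w * A.1) - 1, by
      obtain ⟨A, hA, hu⟩ := A
      refine skewAdjoint.mem_iff.2 ?_
      obtain ⟨u, hu⟩ := isUnit_sub A hu
      have hs : star (u : R) = 1 - star A * w := by simp [hu]
      have hP : (↑u⁻¹ : R) + star (↑u⁻¹ : R) = 1 := by
        have hus : star (↑u⁻¹ : R) * star (u : R) = 1 := by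
          rw [← star_mul, Units.mul_inv, star_one]
        apply u.isUnit.mul_left_cancel
        apply u.isUnit.star.mul_right_cancel
        rw [mul_add, add_mul, Units.mul_inv, one_mul, mul_assoc, hus, mul_one, hs, hu]
        have : star w * A * (star A * w) = 1 := by
          rw [mul_assoc, ← mul_assoc A, hA, one_mul, hw']
        rw [sub_mul, mul_sub, mul_sub, this]
        noncomm_ring
      rw [← hu, Ring.inverse_unit, star_sub, star_mul, star_one, star_ofNat,
        eq_sub_of_add_eq' hP]
      noncomm_ring⟩
    invFun := fun S => ⟨w * (1 - 2 * Ring.inverse (1 + (S : R))), by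
      obtain ⟨u, hu⟩ := isUnit_add S
      have hS : star (S : R) = -S := skewAdjoint.mem_iff.1 S.2
      have hs : star (u : R) = 1 - S := by rw [hu, star_add, hS, star_one, sub_eq_add_neg]
      rw [← hu, Ring.inverse_unit]
      have hus : star (↑u⁻¹ : R) * star (u : R) = 1 := by
        rw [← star_mul, Units.mul_inv, star_one]
      have hQ : (↑u⁻¹ : R) + star (↑u⁻¹ : R) = 2 * (↑u⁻¹ * star (↑u⁻¹ : R)) := by
        apply u.isUnit.mul_left_cancel
        apply u.isUnit.star.mul_right_cancel
        rw [two_mul, mul_add, mul_add, add_mul, add_mul, Units.mul_inv, one_mul, mul_assoc, hus,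
          ← mul_assoc, Units.mul_inv, one_mul, hus, mul_one, hs, hu]
        noncomm_ring
      constructor
      · have h : (1 - 2 * (↑u⁻¹ : R)) * (1 - star (↑u⁻¹ : R) * 2) = 1 := by
          have : (1 - 2 * (↑u⁻¹ : R)) * (1 - star (↑u⁻¹ : R) * 2) =
              1 - 2 * (↑u⁻¹ + star (↑u⁻¹ : R)) + 4 * (↑u⁻¹ * star (↑u⁻¹ : R)) := by
            noncomm_ring
          rw [this, hQ]
          noncomm_ring
        rw [star_mul, star_sub, star_mul, star_one, star_ofNat, mul_assoc, ← mul_assoc _ _ (star w),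
          h, one_mul, hw]
      · have h : w * (1 - 2 * (↑u⁻¹ : R)) - w = -(w * (2 * ↑u⁻¹)) := by noncomm_ring
        rw [h]
        exact (isUnit_w.mul (h2.mul u⁻¹.isUnit)).neg⟩
    left_inv := fun ⟨A, hA, hu⟩ => by
      ext
      obtain ⟨u, hu⟩ := isUnit_sub A hu
      simp only [← hu, Ring.inverse_unit, add_sub_cancel, two_mul_inverse_two_mul_inv h2]
      rw [hu, sub_sub_cancel, ← mul_assoc, hw, one_mul]
    right_inv := fun S => by
      ext
      obtain ⟨u, hu⟩ := isUnit_add S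
      simp only [← hu, Ring.inverse_unit, ← mul_assoc, hw', one_mul, sub_sub_cancel,
        two_mul_inverse_two_mul_inv h2]
      rw [hu, add_sub_cancel_left]
    continuous_toFun := by
      refine Continuous.subtype_mk ?_ _
      refine (continuous_const.mul (continuous_iff_continuousAt.2 fun A => ?_)).sub continuous_const
      obtain ⟨u, hu⟩ := isUnit_sub A.1 A.2.2
      have := hinv u
      rw [hu] at this
      exact this.comp (f := fun A : {A : R // A * star A = 1 ∧ IsUnit (A - w)} =>
        1 - star w * A.1) (by fun_prop)
    continuous_invFun := by
      refine Continuous.subtype_mk ?_ _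
      refine continuous_const.mul (continuous_const.sub (continuous_const.mul
        (continuous_iff_continuousAt.2 fun S => ?_)))
      obtain ⟨u, hu⟩ := isUnit_add S
      have := hinv u
      rw [hu] at this
      exact this.comp (f := fun S : skewAdjoint.submodule ℝ R => 1 + (S : R)) (by fun_prop) }

theorem Quaternion.matrix_conjTranspose_mul_self_eq_zero {m n : Type*} [Fintype m]
    {X : Matrix m n ℍ[ℝ]} (h : Xᴴ * X = 0) : X = 0 := by
  ext1 i j
  have hj : ∑ k, normSq (X k j) = 0 := by
    have := congrFun (congrFun h j) j
    simp only [mul_apply, conjTranspose_apply, star_mul_self,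
      Matrix.zero_apply] at this
    apply (algebraMap ℝ ℍ[ℝ]).injective
    simpa [algebraMap_def] using this
  exact normSq_eq_zero.1 <|
    (Finset.sum_eq_zero_iff_of_nonneg fun _ _ => normSq_nonneg).1 hj i (Finset.mem_univ i)

theorem Quaternion.isUnit_one_add_of_conjTranspose_eq_neg {n : Type*} [Fintype n] [DecidableEq n]
    {S : Matrix n n ℍ[ℝ]} (hS : Sᴴ = -S) : IsUnit (1 + S) := by
  have hinj : Function.Injective (LinearMap.mulLeft ℝ (1 + S)) := by
    refine (injective_iff_map_eq_zero _).2 fun X hX => ?_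
    rw [LinearMap.mulLeft_apply, add_mul, one_mul] at hX
    apply matrix_conjTranspose_mul_self_eq_zero
    have h1 : Xᴴ * X = -(Xᴴ * (S * X)) := by
      rw [← mul_neg, ← eq_neg_of_add_eq_zero_left hX]
    have h2 : Xᴴ * X = Xᴴ * (S * X) := by
      have := congrArg conjTranspose h1
      simpa [hS, Matrix.mul_assoc] using this
    have h3 : (2 : ℝ) • (Xᴴ * X) = 0 := by
      rw [two_smul]
      nth_rewrite 1 [h1]
      rw [h2, neg_add_cancel]
    simpa using h3
  obtain ⟨Y, hY⟩ := LinearMap.surjective_of_injective hinj 1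
  exact IsUnit.of_mul_eq_one Y hY

open scoped Matrix.Norms.Operator in
theorem Quaternion.continuousAt_matrix_inverse {n : Type*} [Fintype n] [DecidableEq n]
    (u : (Matrix n n ℍ[ℝ])ˣ) : ContinuousAt Ring.inverse (u : Matrix n n ℍ[ℝ]) :=
  NormedRing.inverse_continuousAt u

theorem omega_sigma_contractible (σ : ℍ[ℝ]) (hσ : ‖σ‖ = 1) :
    ContractibleSpace
      {A : Matrix (Fin 2) (Fin 2) ℍ[ℝ] //
        A * Aᴴ = 1 ∧ IsUnit (A - σ • (1 : Matrix (Fin 2) (Fin 2) ℍ[ℝ]))} := by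
  have hn : normSq σ = 1 := by rw [normSq_eq_norm_mul_self, hσ, one_mul]
  have hw : (σ • (1 : Matrix (Fin 2) (Fin 2) ℍ[ℝ])) * star (σ • 1) = 1 := by
    simp [smul_one_eq_diagonal, star_eq_conjTranspose, self_mul_star, hn]
  have hw' : star (σ • (1 : Matrix (Fin 2) (Fin 2) ℍ[ℝ])) * (σ • 1) = 1 := by
    simp [smul_one_eq_diagonal, star_eq_conjTranspose, star_mul_self, hn]
  have : StarModule ℝ ℍ[ℝ] := ⟨fun r a => by simp [Quaternion.star_smul]⟩
  exact (cayleyHomeomorph continuousAt_matrix_inverse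
    (fun _ => isUnit_one_add_of_conjTranspose_eq_neg) hw hw').contractibleSpace
end

section
/- Let σ₁, σ₂, σ₃, σ₄ be quaternions of norm 1 and let M be the real 4×4 matrix whose m-th row consists of the four real coordinates (tₘ, xₘ, yₘ, zₘ) of σₘ = tₘ + xₘi + yₘj + zₘk. If M is invertible, then the vector M⁻¹·u, where u = (1,1,1,1)ᵗ, has Euclidean norm strictly greater than 1. -/
open Quaternion Matrix

theorem inv_mulVec_ones_norm_gt_one
    (σ : Fin 4 → ℍ[ℝ]) (hσ : ∀ m, ‖σ m‖ = 1)
    (M : Matrix (Fin 4) (Fin 4) ℝ)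
    (hM : ∀ m, M m 0 = (σ m).re ∧ M m 1 = (σ m).imI ∧
               M m 2 = (σ m).imJ ∧ M m 3 = (σ m).imK)
    (hinv : IsUnit M) :
    1 < Real.sqrt (∑ i, (M⁻¹.mulVec (fun _ => (1 : ℝ)) i) ^ 2) := by
  have hdet : IsUnit M.det := (Matrix.isUnit_iff_isUnit_det M).1 hinv
  set v := M⁻¹.mulVec (fun _ => (1 : ℝ)) with hv
  have hMv : M *ᵥ v = fun _ => 1 := by
    rw [hv, mulVec_mulVec, mul_nonsing_inv _ hdet, one_mulVec]
  have hrow (m : Fin 4) : ∑ i, M m i ^ 2 = 1 := by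
    obtain ⟨h0, h1, h2, h3⟩ := hM m
    have h := Quaternion.normSq_eq_norm_mul_self (σ m)
    rw [hσ, Quaternion.normSq_def'] at h
    rw [Fin.sum_univ_four, h0, h1, h2, h3, h, mul_one]
  rw [Real.lt_sqrt zero_le_one, one_pow]
  by_contra! hle
  have heq (m : Fin 4) : M m = v := by
    have hdot : ∑ i, M m i * v i = 1 := congrFun hMv m
    have hsum : ∑ i, (M m i - v i) ^ 2 = ∑ i, M m i ^ 2 - 2 * ∑ i, M m i * v i + ∑ i, v i ^ 2 := by
      rw [Finset.mul_sum, ← Finset.sum_sub_distrib, ← Finset.sum_add_distrib]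
      exact Finset.sum_congr rfl fun i _ => by ring
    have hzero : ∑ i, (M m i - v i) ^ 2 = 0 :=
      le_antisymm (by rw [hsum, hrow, hdot]; linarith) (Finset.sum_nonneg fun i _ => sq_nonneg _)
    rw [Finset.sum_eq_zero_iff_of_nonneg fun i _ => sq_nonneg _] at hzero
    ext i
    exact sub_eq_zero.1 (pow_eq_zero_iff two_ne_zero |>.1 (hzero i (Finset.mem_univ i)))
  exact hdet.ne_zero (det_zero_of_row_eq (zero_ne_one (α := Fin 4)) ((heq 0).trans (heq 1).symm))
end
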